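/- arXiv:1503.04380 — 2 statements merged into one kernel-verified Lean document; each statement's English description precedes it below -/
import Mathlib

section
/- If T is a saturated triangular set in the differential polynomial ring K{y_1,...,y_n}, then dsat(T) is an unmixed radical differential ideal. -/
namespace DTri

/-- The ring of differential polynomials `K{y_1,…,y_n}`: polynomials in the variables
`y_i^{(j)}` indexed by `(i, j) ∈ Fin n × ℕ`. -/
abbrev DPoly (K : Type*) [CommSemiring K] (n : ℕ) := MvPolynomial (Fin n × ℕ) K

/-- Application of a derivation of the coefficient field to all coefficients. -/
noncomputable def coeffDer {K : Type*} [CommSemiring K] {n : ℕ} (δ : K → K) (f : DPoly K n) :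
    DPoly K n :=
  ∑ m ∈ f.support, MvPolynomial.monomial m (δ (MvPolynomial.coeff m f))

/-- The total derivative on `K{y_1,…,y_n}` extending the derivation `δ` of `K` and sending
`y_i^{(j)}` to `y_i^{(j+1)}`. -/
noncomputable def totalDer {K : Type*} [CommSemiring K] {n : ℕ} (δ : K → K) (f : DPoly K n) :
    DPoly K n :=
  coeffDer δ f +
    ∑ v ∈ f.vars, MvPolynomial.pderiv v f * MvPolynomial.X (v.1, v.2 + 1)

/-- The differential ideal `[S]` generated by a set `S` of differential polynomials:
the ideal generated by the elements of `S` and all their iterated total derivatives. -/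
noncomputable def diffSpan {K : Type*} [CommSemiring K] {n : ℕ} (δ : K → K)
    (S : Set (DPoly K n)) : Ideal (DPoly K n) :=
  Ideal.span {g | ∃ f ∈ S, ∃ k : ℕ, g = (totalDer δ)^[k] f}

/-- The ranking on the derivatives `y_i^{(j)}`: `(p, j) ≤ (q, l)` iff `p < q`, or `p = q`
and `j ≤ l`. -/
def rkLE {n : ℕ} (v w : Fin n × ℕ) : Prop := v.1 < w.1 ∨ (v.1 = w.1 ∧ v.2 ≤ w.2)

/-- `y_v` is the leader of the differential polynomial `f`: it occurs in `f` and every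
derivative occurring in `f` has lower or equal rank. -/
def IsLeader {K : Type*} [CommSemiring K] {n : ℕ} (f : DPoly K n) (v : Fin n × ℕ) : Prop :=
  v ∈ f.vars ∧ ∀ w ∈ f.vars, rkLE w v

/-- The initial of `f` with respect to the variable `v`: the leading coefficient of `f`
viewed as a univariate polynomial in `v`. -/
noncomputable def initialD {K : Type*} [CommSemiring K] {n : ℕ} (f : DPoly K n)
    (v : Fin n × ℕ) : DPoly K n :=
  ∑ m ∈ f.support.filter (fun m => m v = MvPolynomial.degreeOf v f),
    MvPolynomial.monomial (Finsupp.erase v m) (MvPolynomial.coeff m f)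

/-- The order of `f` in the differential indeterminate `y_α`. -/
noncomputable def ordIn {K : Type*} [CommSemiring K] {n : ℕ} (f : DPoly K n) (α : Fin n) : ℕ :=
  (f.vars.filter fun v => v.1 = α).sup fun v => v.2

/-- The (total) order of `f`. -/
noncomputable def ordTot {K : Type*} [CommSemiring K] {n : ℕ} (f : DPoly K n) : ℕ :=
  f.vars.sup fun v => v.2

/-- `T` (with classes `cs` and leading orders `os`) is a differential triangular set:
the classes are pairwise distinct (increasing) and `y_{cs j}^{(os j)}` is the leader of
`T j`. -/
def DTriangular {K : Type*} [CommSemiring K] {n r : ℕ} (T : Fin r → DPoly K n)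
    (cs : Fin r → Fin n) (os : Fin r → ℕ) : Prop :=
  StrictMono cs ∧ ∀ j, IsLeader (T j) (cs j, os j)

/-- `p` involves none of the differential indeterminates whose index lies in `cvars`. -/
def paramFreeD {K : Type*} [CommSemiring K] {n : ℕ} (cvars : Set (Fin n)) (p : DPoly K n) :
    Prop :=
  ∀ v ∈ p.vars, v.1 ∉ cvars

/-- `f` is invertible with respect to the system `S` whose classes are `cvars`:
`[f, S] ∩ K{u} ≠ {0}` where `u` consists of the differential indeterminates outside
`cvars`. -/
noncomputable def DInvertible {K : Type*} [CommRing K] {n : ℕ} (δ : K → K) (f : DPoly K n)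
    (S : Set (DPoly K n)) (cvars : Set (Fin n)) : Prop :=
  ∃ p ∈ diffSpan δ ({f} ∪ S), p ≠ 0 ∧ paramFreeD cvars p

/-- `T` is a regular differential triangular set: each initial `I_{T_i}` is invertible
with respect to `{T_1, …, T_{i-1}}`. -/
noncomputable def DRegular {K : Type*} [CommRing K] {n r : ℕ} (δ : K → K)
    (T : Fin r → DPoly K n) (cs : Fin r → Fin n) (os : Fin r → ℕ) : Prop :=
  DTriangular T cs os ∧
    ∀ i : Fin r, DInvertible δ (initialD (T i) (cs i, os i))
      (T '' {j | j < i}) (cs '' {j | j < i})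

/-- `T` is a saturated differential triangular set: it is regular and each separant
`S_{T_i}` is invertible with respect to `{T_1, …, T_i}`. -/
noncomputable def DSaturated {K : Type*} [CommRing K] {n r : ℕ} (δ : K → K)
    (T : Fin r → DPoly K n) (cs : Fin r → Fin n) (os : Fin r → ℕ) : Prop :=
  DRegular δ T cs os ∧
    ∀ i : Fin r, DInvertible δ (MvPolynomial.pderiv (cs i, os i) (T i))
      (T '' {j | j ≤ i}) (cs '' {j | j ≤ i})

/-- The product `I_T · S_T` of the initials and separants of a differential triangular
set. -/
noncomputable def initSepProd {K : Type*} [CommSemiring K] {n r : ℕ} (T : Fin r → DPoly K n)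
    (cs : Fin r → Fin n) (os : Fin r → ℕ) : DPoly K n :=
  (∏ j, initialD (T j) (cs j, os j)) * ∏ j, MvPolynomial.pderiv (cs j, os j) (T j)

/-- The saturation `{f | ∃ d, a ^ d * f ∈ J}` of an ideal `J` by an element `a`. -/
def saturationBy {R : Type*} [CommRing R] (J : Ideal R) (a : R) : Ideal R where
  carrier := {f | ∃ d : ℕ, a ^ d * f ∈ J}
  zero_mem' := ⟨0, by simp⟩
  add_mem' := by
    rintro f g ⟨d1, h1⟩ ⟨d2, h2⟩
    refine ⟨d1 + d2, ?_⟩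
    have h : a ^ (d1 + d2) * (f + g)
        = a ^ d2 * (a ^ d1 * f) + a ^ d1 * (a ^ d2 * g) := by ring
    rw [h]
    exact J.add_mem (J.mul_mem_left _ h1) (J.mul_mem_left _ h2)
  smul_mem' := by
    rintro c f ⟨d, h⟩
    exact ⟨d, by rw [smul_eq_mul, mul_left_comm]; exact J.mul_mem_left c h⟩

/-- The saturation differential ideal
`dsat(T) = {f | ∃ d, (I_T S_T)^d f ∈ [T_1, …, T_r]}`. -/
noncomputable def dsat {K : Type*} [CommRing K] {n r : ℕ} (δ : K → K)
    (T : Fin r → DPoly K n) (cs : Fin r → Fin n) (os : Fin r → ℕ) :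
    Ideal (DPoly K n) :=
  saturationBy (diffSpan δ (Set.range T)) (initSepProd T cs os)

/-- An ideal of `K{y_1,…,y_n}` is a differential ideal if it is closed under the total
derivative. -/
def IsDiffIdeal {K : Type*} [CommSemiring K] {n : ℕ} (δ : K → K) (I : Ideal (DPoly K n)) :
    Prop :=
  ∀ f ∈ I, totalDer δ f ∈ I

/-- `I` is a minimal prime differential ideal over `J`; these correspond to the
irreducible components of `Zero(J)`. -/
def MinDiffPrimeOver {K : Type*} [CommSemiring K] {n : ℕ} (δ : K → K)
    (J I : Ideal (DPoly K n)) : Prop :=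
  I.IsPrime ∧ IsDiffIdeal δ I ∧ J ≤ I ∧
    ∀ I' : Ideal (DPoly K n), I'.IsPrime → IsDiffIdeal δ I' → J ≤ I' → I' ≤ I → I' = I

/-- `M` is not identically zero on any irreducible component of `Zero(J)`: `M` lies in no
minimal prime differential ideal over `J`. -/
def NotIdZeroOnDiffComponents {K : Type*} [CommSemiring K] {n : ℕ} (δ : K → K)
    (J : Ideal (DPoly K n)) (M : DPoly K n) : Prop :=
  ∀ I, MinDiffPrimeOver δ J I → M ∉ I

/-- The differential dimension of a prime differential ideal `I`: the largest number of
differential indeterminates `S` such that `I ∩ K{y_i : i ∈ S} = {0}`. -/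
noncomputable def diffDim {K : Type*} [CommSemiring K] {n : ℕ} (I : Ideal (DPoly K n)) : ℕ :=
  sSup {k : ℕ | ∃ s : Finset (Fin n), s.card = k ∧
    ∀ f ∈ I, (∀ v ∈ f.vars, v.1 ∈ s) → f = 0}

/-- A differential ideal is unmixed if all of its prime components have the same
(differential) dimension. -/
noncomputable def DiffUnmixed {K : Type*} [CommSemiring K] {n : ℕ} (δ : K → K)
    (J : Ideal (DPoly K n)) : Prop :=
  ∀ p q : Ideal (DPoly K n), MinDiffPrimeOver δ J p → MinDiffPrimeOver δ J q →
    diffDim p = diffDim q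

/-- Evaluation of a differential polynomial at a point `x ∈ E^n` of a differential
extension `(E, δE)` of `K`: the derivative `y_i^{(j)}` takes the value `δE^[j] (x i)`. -/
noncomputable def deval {K : Type*} [CommSemiring K] {n : ℕ} {E : Type*} [CommSemiring E]
    [Algebra K E] (δE : E → E) (x : Fin n → E) (f : DPoly K n) : E :=
  MvPolynomial.aeval (fun v : Fin n × ℕ => δE^[v.2] (x v.1)) f

/-- The zero set `Zero(S/D) ⊆ E^n` of a system `S` of differential polynomials together
with an inequation `D ≠ 0`. -/
noncomputable def dZeroSet {K : Type*} [CommSemiring K] {n : ℕ} {E : Type*} [CommSemiring E]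
    [Algebra K E] (δE : E → E) (S : Set (DPoly K n)) (D : DPoly K n) : Set (Fin n → E) :=
  {x | (∀ f ∈ S, deval δE x f = 0) ∧ deval δE x D ≠ 0}

/-- The zero set `Zero(I) ⊆ E^n` of a (differential) ideal `I`. -/
noncomputable def dZeroSetI {K : Type*} [CommSemiring K] {n : ℕ} {E : Type*} [CommSemiring E]
    [Algebra K E] (δE : E → E) (I : Ideal (DPoly K n)) : Set (Fin n → E) :=
  {x | ∀ f ∈ I, deval δE x f = 0}

/-- The Kolchin closure of a set `S ⊆ E^n`: the zero set of all differential polynomials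
vanishing identically on `S`. -/
noncomputable def kClosure (K : Type*) [CommSemiring K] {n : ℕ} {E : Type*} [CommSemiring E]
    [Algebra K E] (δE : E → E) (S : Set (Fin n → E)) : Set (Fin n → E) :=
  {x | ∀ f : DPoly K n, (∀ y ∈ S, deval δE y f = 0) → deval δE x f = 0}

end DTri

open MvPolynomial in
theorem DTri.lazard_etale {A ι : Type*} [CommRing A] [Finite ι] [LinearOrder ι]
    (g : ι → MvPolynomial ι A) (H : MvPolynomial ι A)
    (htri : ∀ i j, j < i → pderiv i (g j) = 0)
    (hsep : ∀ i, pderiv i (g i) ∣ H) :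
    Algebra.Etale A (Localization.Away
      (Ideal.Quotient.mk (Ideal.span (Set.range g)) H)) := by
  classical
  cases nonempty_fintype ι
  set B := MvPolynomial ι A ⧸ Ideal.span (Set.range g)
  set h : B := Ideal.Quotient.mk (Ideal.span (Set.range g)) H
  let P : Algebra.PreSubmersivePresentation A B ι ι :=
    Algebra.PreSubmersivePresentation.naive (v := g) id Function.injective_id
  let Q := Algebra.PreSubmersivePresentation.localizationAway (Localization.Away h) h
  have hdet : P.jacobiMatrix.det = ∏ i, pderiv i (g i) := by
    have hM : P.jacobiMatrix = Matrix.of (fun i j => pderiv i (g j)) := by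
      ext1 i j
      exact Algebra.PreSubmersivePresentation.jacobiMatrix_naive _ _ _ _ i j
    rw [hM, Matrix.det_of_isUpperTriangular]
    · rfl
    · intro i j hij
      exact htri i j hij
  have hu : IsUnit (algebraMap B (Localization.Away h) h) :=
    IsLocalization.Away.algebraMap_isUnit h
  have hPj : P.jacobian = Ideal.Quotient.mk (Ideal.span (Set.range g)) (∏ i, pderiv i (g i)) := by
    rw [Algebra.PreSubmersivePresentation.jacobian_eq_jacobiMatrix_det, hdet]
    rfl
  have hunit : IsUnit (Q.comp P).jacobian := by
    rw [Algebra.PreSubmersivePresentation.comp_jacobian_eq_jacobian_smul_jacobian,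
      Algebra.smul_def]
    refine IsUnit.mul ?_ ?_
    · rw [hPj, map_prod, map_prod]
      rw [IsUnit.prod_univ_iff]
      intro i
      exact isUnit_of_dvd_unit ((algebraMap B _).map_dvd (map_dvd _ (hsep i))) hu
    · rw [Algebra.PreSubmersivePresentation.localizationAway_jacobian]
      exact hu
  let S : Algebra.SubmersivePresentation A (Localization.Away h) (Unit ⊕ ι) (Unit ⊕ ι) :=
    { Q.comp P with jacobian_isUnit := hunit }
  have : Algebra.IsStandardSmoothOfRelativeDimension 0 A (Localization.Away h) :=
    S.isStandardSmoothOfRelativeDimension (by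
      simp [Algebra.Presentation.dimension])
  infer_instance

theorem DTri.mem_saturationBy_iff {R : Type*} [CommRing R] (J : Ideal R) (H f : R) :
    f ∈ DTri.saturationBy J H ↔
      algebraMap _ (Localization.Away (Ideal.Quotient.mk J H)) (Ideal.Quotient.mk J f) = 0 := by
  rw [IsLocalization.map_eq_zero_iff (Submonoid.powers (Ideal.Quotient.mk J H))]
  constructor
  · rintro ⟨d, hd⟩
    refine ⟨⟨_, d, rfl⟩, ?_⟩
    change (Ideal.Quotient.mk J H) ^ d * _ = 0
    rw [← map_pow, ← map_mul]
    exact Ideal.Quotient.eq_zero_iff_mem.mpr hd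
  · rintro ⟨⟨_, d, rfl⟩, hd⟩
    refine ⟨d, ?_⟩
    rw [← Ideal.Quotient.eq_zero_iff_mem, map_mul, map_pow]
    exact hd

theorem DTri.etale_reduced {A C : Type*} [CommRing A] [IsDomain A] [CommRing C] [Algebra A C]
    [Algebra.Etale A C] : IsReduced C := by
  let F := FractionRing A
  have hr : IsReduced (TensorProduct A F C) :=
    Algebra.FormallyUnramified.isReduced_of_field F _
  have hinj : Function.Injective
      (Algebra.TensorProduct.includeRight : C →ₐ[A] TensorProduct A F C) :=
    Algebra.TensorProduct.includeRight_injective (IsFractionRing.injective A F)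
  exact isReduced_of_injective _ hinj

open MvPolynomial in
theorem DTri.lazard_finite {A ι : Type*} [CommRing A] [IsDomain A] [Finite ι] [LinearOrder ι]
    (g : ι → MvPolynomial ι A) (H : MvPolynomial ι A)
    (htri : ∀ i j, j < i → pderiv i (g j) = 0)
    (hsep : ∀ i, pderiv i (g i) ∣ H) :
    (∀ (f : MvPolynomial ι A) (k : ℕ), f ^ k ∈ DTri.saturationBy (Ideal.span (Set.range g)) H →
      f ∈ DTri.saturationBy (Ideal.span (Set.range g)) H) ∧
    (∀ (a : A) (f : MvPolynomial ι A), a ≠ 0 →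
      C a * f ∈ DTri.saturationBy (Ideal.span (Set.range g)) H →
      f ∈ DTri.saturationBy (Ideal.span (Set.range g)) H) := by
  have := DTri.lazard_etale g H htri hsep
  have hred : IsReduced (Localization.Away
      (Ideal.Quotient.mk (Ideal.span (Set.range g)) H)) := DTri.etale_reduced (A := A)
  have hflat : Module.Flat A (Localization.Away
      (Ideal.Quotient.mk (Ideal.span (Set.range g)) H)) := inferInstance
  constructor
  · intro f k hf
    rw [DTri.mem_saturationBy_iff] at hf ⊢
    rw [map_pow, map_pow] at hf
    exact eq_zero_of_pow_eq_zero hf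
  · intro a f ha hf
    rw [DTri.mem_saturationBy_iff] at hf ⊢
    rw [map_mul, map_mul] at hf
    have hreg := Module.Flat.isSMulRegular_of_nonZeroDivisors (R := A) (M := Localization.Away
      (Ideal.Quotient.mk (Ideal.span (Set.range g)) H)) (mem_nonZeroDivisors_of_ne_zero ha)
    refine hreg.right_eq_zero_of_smul ?_
    rw [Algebra.smul_def]
    exact hf

theorem DTri.sat_map_equiv {R S : Type*} [CommRing R] [CommRing S] (e : R ≃+* S)
    (J : Ideal R) (H f : R) :
    e f ∈ DTri.saturationBy (J.map e) (e H) ↔ f ∈ DTri.saturationBy J H := by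
  have key : ∀ x : R, e x ∈ J.map e ↔ x ∈ J := by
    intro x
    rw [Ideal.mem_map_of_equiv]
    constructor
    · rintro ⟨y, hy, hxy⟩
      rwa [← e.injective hxy]
    · intro hx
      exact ⟨x, hx, rfl⟩
  constructor
  · rintro ⟨d, hd⟩
    refine ⟨d, (key _).1 ?_⟩
    rwa [map_mul, map_pow]
  · rintro ⟨d, hd⟩
    refine ⟨d, ?_⟩
    rw [← map_pow, ← map_mul]
    exact (key _).2 hd

open MvPolynomial in
theorem DTri.lazard_inj {K σ ι : Type*} [Field K] [Finite ι] [LinearOrder ι]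
    (v : ι → σ) (hv : Function.Injective v)
    (g : ι → MvPolynomial σ K) (H : MvPolynomial σ K)
    (htri : ∀ i j, j < i → pderiv (v i) (g j) = 0)
    (hsep : ∀ i, pderiv (v i) (g i) ∣ H) :
    (∀ (f : MvPolynomial σ K) (k : ℕ), f ^ k ∈ DTri.saturationBy (Ideal.span (Set.range g)) H →
      f ∈ DTri.saturationBy (Ideal.span (Set.range g)) H) ∧
    (∀ (a f : MvPolynomial σ K), a ≠ 0 → (∀ w ∈ a.vars, w ∉ Set.range v) →
      a * f ∈ DTri.saturationBy (Ideal.span (Set.range g)) H →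
      f ∈ DTri.saturationBy (Ideal.span (Set.range g)) H) := by
  classical
  let e : ι ⊕ ↥(Set.range v)ᶜ ≃ σ :=
    ((Equiv.ofInjective v hv).sumCongr (Equiv.refl _)).trans (Equiv.Set.sumCompl (Set.range v))
  have he1 : ∀ i, e (Sum.inl i) = v i := fun i => rfl
  have he2 : ∀ i, e (Sum.inr i) = i.1 := fun i => rfl
  let Φ : MvPolynomial σ K ≃ₐ[K] MvPolynomial ι (MvPolynomial ↥(Set.range v)ᶜ K) :=
    (renameEquiv K e.symm).trans (sumAlgEquiv K ι _)
  have hp : ∀ i f, pderiv i (Φ f) = Φ (pderiv (v i) f) := by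
    intro i f
    change pderiv i (sumAlgEquiv K ι _ (rename e.symm f)) =
      sumAlgEquiv K ι _ (rename e.symm (pderiv (v i) f))
    rw [pderiv_sumAlgEquiv, ← pderiv_rename e.symm.injective, ← he1 i, Equiv.symm_apply_apply]
  have hC : ∀ q : MvPolynomial ↥(Set.range v)ᶜ K, Φ (rename Subtype.val q) = C q := by
    intro q
    induction q using MvPolynomial.induction_on with
    | C a => simp [Φ]
    | add p q hp hq => rw [map_add, map_add, hp, hq, map_add]
    | mul_X p j hp =>
      rw [map_mul, map_mul, hp, map_mul, rename_X]
      congr 1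
      change sumAlgEquiv K ι _ (rename e.symm (X j.1)) = _
      rw [rename_X, ← he2 j, Equiv.symm_apply_apply]
      simp
  have hspan : (Ideal.span (Set.range g)).map (Φ : MvPolynomial σ K ≃+* MvPolynomial ι (MvPolynomial ↥(Set.range v)ᶜ K)) =
      Ideal.span (Set.range (fun i => Φ (g i))) := by
    rw [Ideal.map_span, ← Set.range_comp]
    rfl
  have hiff : ∀ f, Φ f ∈ DTri.saturationBy (Ideal.span (Set.range (fun i => Φ (g i)))) (Φ H) ↔
      f ∈ DTri.saturationBy (Ideal.span (Set.range g)) H := by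
    intro f
    rw [← hspan]
    exact DTri.sat_map_equiv (Φ : MvPolynomial σ K ≃+* MvPolynomial ι (MvPolynomial ↥(Set.range v)ᶜ K)) _ H f
  obtain ⟨h1, h2⟩ := DTri.lazard_finite (fun i => Φ (g i)) (Φ H)
    (fun i j hij => by rw [hp, htri i j hij, map_zero])
    (fun i => by rw [hp]; exact map_dvd Φ (hsep i))
  constructor
  · intro f k hf
    rw [← hiff] at hf ⊢
    rw [map_pow] at hf
    exact h1 _ k hf
  · intro a f ha hav hf
    obtain ⟨q, rfl⟩ := exists_rename_eq_of_vars_subset_range a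
      (Subtype.val : ↥(Set.range v)ᶜ → σ) Subtype.val_injective (by
        intro w hw
        exact ⟨⟨w, hav w hw⟩, rfl⟩)
    rw [← hiff] at hf ⊢
    rw [map_mul, hC] at hf
    refine h2 q _ ?_ hf
    rintro rfl
    simp at ha

theorem DTri.sat_mono {R : Type*} [CommRing R] {J J' : Ideal R} (h : J ≤ J') (H : R) :
    DTri.saturationBy J H ≤ DTri.saturationBy J' H := by
  rintro f ⟨d, hd⟩
  exact ⟨d, h hd⟩

theorem DTri.sat_finset {R ι : Type*} [CommRing R] (g : ι → R) (H f : R)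
    (hf : f ∈ DTri.saturationBy (Ideal.span (Set.range g)) H) :
    ∃ s : Finset ι, f ∈ DTri.saturationBy (Ideal.span (Set.range (fun i : s => g i))) H := by
  classical
  obtain ⟨d, hd⟩ := hf
  obtain ⟨t, ht, hdt⟩ := Submodule.mem_span_finite_of_mem_span hd
  rw [← Set.image_univ] at ht
  obtain ⟨s, -, hs⟩ := Finset.subset_set_image_iff.1 ht
  refine ⟨s, d, ?_⟩
  refine Ideal.span_mono ?_ hdt
  rw [← hs]
  intro x hx
  simp only [Finset.coe_image, Set.mem_image] at hx
  obtain ⟨i, hi, rfl⟩ := hx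
  exact ⟨⟨i, hi⟩, rfl⟩

open MvPolynomial in
theorem DTri.lazard {K σ ι : Type*} [Field K] [LinearOrder ι]
    (v : ι → σ) (hv : Function.Injective v)
    (g : ι → MvPolynomial σ K) (H : MvPolynomial σ K)
    (htri : ∀ i j, j < i → pderiv (v i) (g j) = 0)
    (hsep : ∀ i, pderiv (v i) (g i) ∣ H) :
    (DTri.saturationBy (Ideal.span (Set.range g)) H).IsRadical ∧
    (∀ (a f : MvPolynomial σ K), a ≠ 0 → (∀ w ∈ a.vars, w ∉ Set.range v) →
      a * f ∈ DTri.saturationBy (Ideal.span (Set.range g)) H →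
      f ∈ DTri.saturationBy (Ideal.span (Set.range g)) H) := by
  have hmono : ∀ s : Finset ι, DTri.saturationBy (Ideal.span (Set.range (fun i : s => g i))) H ≤
      DTri.saturationBy (Ideal.span (Set.range g)) H := by
    intro s
    apply DTri.sat_mono
    apply Ideal.span_mono
    rintro _ ⟨i, rfl⟩
    exact ⟨i, rfl⟩
  have hfin := fun s : Finset ι => DTri.lazard_inj (fun i : s => v i)
    (hv.comp Subtype.val_injective) (fun i : s => g i) H
    (fun i j hij => htri i j hij) (fun i => hsep i)
  constructor
  · rintro f ⟨k, hk⟩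
    obtain ⟨s, hs⟩ := DTri.sat_finset g H _ hk
    exact hmono s ((hfin s).1 f k hs)
  · intro a f ha hav hf
    obtain ⟨s, hs⟩ := DTri.sat_finset g H _ hf
    refine hmono s ((hfin s).2 a f ha ?_ hs)
    rintro w hw ⟨i, rfl⟩
    exact hav _ hw ⟨i, rfl⟩

namespace DTri

open MvPolynomial

theorem coeff_coeffDer {K : Type*} [Field K] [CharZero K] {n : ℕ} (δ : Derivation ℚ K K)
    (f : DPoly K n) (m : Fin n × ℕ →₀ ℕ) : coeff m (coeffDer δ f) = δ (coeff m f) := by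
  classical
  unfold coeffDer
  rw [coeff_sum]
  simp only [coeff_monomial]
  rw [Finset.sum_ite_eq' f.support m]
  split_ifs with h
  · rfl
  · rw [notMem_support_iff.1 h, map_zero]

theorem coeffDer_monomial {K : Type*} [Field K] [CharZero K] {n : ℕ} (δ : Derivation ℚ K K)
    (m : Fin n × ℕ →₀ ℕ) (a : K) :
    coeffDer δ (monomial m a : DPoly K n) = monomial m (δ a) := by
  classical
  ext k
  rw [coeff_coeffDer, coeff_monomial, coeff_monomial]
  split_ifs <;> simp

theorem coeffDer_add {K : Type*} [Field K] [CharZero K] {n : ℕ} (δ : Derivation ℚ K K)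
    (f g : DPoly K n) : coeffDer δ (f + g) = coeffDer δ f + coeffDer δ g := by
  ext k
  simp [coeff_coeffDer]

theorem coeffDer_mul {K : Type*} [Field K] [CharZero K] {n : ℕ} (δ : Derivation ℚ K K)
    (f g : DPoly K n) : coeffDer δ (f * g) = f * coeffDer δ g + g * coeffDer δ f := by
  induction f using MvPolynomial.induction_on' with
  | add p q hp hq => rw [add_mul, coeffDer_add, hp, hq, coeffDer_add]; ring
  | monomial u a =>
    induction g using MvPolynomial.induction_on' with
    | add p q hp hq => rw [mul_add, coeffDer_add, hp, hq, coeffDer_add]; ring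
    | monomial w b =>
      simp only [monomial_mul, coeffDer_monomial, Derivation.leibniz, smul_eq_mul, map_add,
        add_comm w u]

/-- The non-coefficient part of the total derivative, as a derivation. -/
noncomputable def shiftDer (K : Type*) [Field K] (n : ℕ) :
    Derivation K (DPoly K n) (DPoly K n) :=
  mkDerivation K (fun v : Fin n × ℕ => (X (v.1, v.2 + 1) : DPoly K n))

theorem totalDer_eq {K : Type*} [Field K] (δ : K → K) {n : ℕ} (f : DPoly K n) :
    totalDer δ f = coeffDer δ f + shiftDer K n f := by
  classical
  unfold totalDer
  congr 1
  let E : Derivation K (DPoly K n) (DPoly K n) :=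
    ∑ v ∈ f.vars, (X (v.1, v.2 + 1) : DPoly K n) • pderiv v
  have hE : ∀ g, E g = ∑ v ∈ f.vars, pderiv v g * X (v.1, v.2 + 1) := by
    intro g
    have : E g = ∑ v ∈ f.vars, ((X (v.1, v.2 + 1) : DPoly K n) • pderiv v :
        Derivation K (DPoly K n) (DPoly K n)) g := by
      simp only [E]
      rw [← Derivation.coeFnAddMonoidHom_apply, map_sum, Finset.sum_apply]
      rfl
    rw [this]
    refine Finset.sum_congr rfl fun v _ => ?_
    rw [Derivation.smul_apply, smul_eq_mul, mul_comm]
  rw [← hE]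
  apply derivation_eq_of_forall_mem_vars
  intro i hi
  rw [hE, shiftDer, mkDerivation_X]
  simp only [pderiv_X, Pi.single_apply]
  simp [hi]

theorem totalDer_add {K : Type*} [Field K] [CharZero K] {n : ℕ} (δ : Derivation ℚ K K)
    (f g : DPoly K n) : totalDer δ (f + g) = totalDer δ f + totalDer δ g := by
  simp only [totalDer_eq, coeffDer_add, map_add]; ring

theorem totalDer_mul {K : Type*} [Field K] [CharZero K] {n : ℕ} (δ : Derivation ℚ K K)
    (f g : DPoly K n) : totalDer δ (f * g) = f * totalDer δ g + g * totalDer δ f := by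
  simp only [totalDer_eq, coeffDer_mul, Derivation.leibniz, smul_eq_mul]; ring

theorem totalDer_zero {K : Type*} [Field K] [CharZero K] {n : ℕ} (δ : Derivation ℚ K K) :
    totalDer δ (0 : DPoly K n) = 0 := by
  have := totalDer_add δ (0 : DPoly K n) 0
  simpa using this

theorem pderiv_coeffDer {K : Type*} [Field K] [CharZero K] {n : ℕ} (δ : Derivation ℚ K K)
    (w : Fin n × ℕ) (f : DPoly K n) :
    pderiv w (coeffDer δ f) = coeffDer δ (pderiv w f) := by
  induction f using MvPolynomial.induction_on' with
  | add p q hp hq => rw [coeffDer_add, map_add, map_add, coeffDer_add, hp, hq]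
  | monomial u a =>
    rw [coeffDer_monomial, pderiv_monomial, pderiv_monomial, coeffDer_monomial]
    congr 1
    simp [Derivation.leibniz, mul_comm]

theorem pderiv_shiftDer {K : Type*} [Field K] {n : ℕ} (c : Fin n) (j : ℕ) (f : DPoly K n) :
    pderiv (c, j + 1) (shiftDer K n f) =
      shiftDer K n (pderiv (c, j + 1) f) + pderiv (c, j) f := by
  classical
  have h : ⁅(pderiv (c, j + 1) : Derivation K (DPoly K n) (DPoly K n)), shiftDer K n⁆ =
      pderiv (c, j) := by
    apply derivation_ext
    intro i
    rw [Derivation.commutator_apply, shiftDer, mkDerivation_X]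
    simp only [pderiv_X, Pi.single_apply]
    have h0' : (mkDerivation K (fun v : Fin n × ℕ => (X (v.1, v.2 + 1) : DPoly K n)))
        (if i = (c, j + 1) then 1 else 0) = 0 := by
      split_ifs <;> simp
    simp only [h0', sub_zero]
    obtain ⟨a, b⟩ := i
    simp [Prod.ext_iff]
  rw [← h, Derivation.commutator_apply]
  ring

theorem pderiv_totalDer {K : Type*} [Field K] [CharZero K] {n : ℕ} (δ : Derivation ℚ K K)
    (c : Fin n) (j : ℕ) (f : DPoly K n) :
    pderiv (c, j + 1) (totalDer δ f) =
      totalDer δ (pderiv (c, j + 1) f) + pderiv (c, j) f := by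
  simp only [totalDer_eq, map_add, pderiv_coeffDer, pderiv_shiftDer]; ring

theorem pderiv_zero_of_notMem {K σ : Type*} [CommSemiring K] {f : MvPolynomial σ K} {w : σ}
    (h : w ∉ f.vars) : pderiv w f = 0 := by
  classical
  apply derivation_eq_zero_of_forall_mem_vars
  intro i hi
  rw [pderiv_X, Pi.single_apply, if_neg]
  rintro rfl
  exact h hi

theorem vars_pderiv_subset {K σ : Type*} [CommSemiring K] (f : MvPolynomial σ K) (w : σ) :
    (pderiv w f).vars ⊆ f.vars := by
  classical
  have hf : f ∈ supported K (f.vars : Set σ) := f.mem_supported_vars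
  rw [supported_eq_range_rename] at hf
  by_cases hw : w ∈ f.vars
  · obtain ⟨q, hq⟩ := hf
    have hq' : rename Subtype.val q = f := hq
    have : pderiv w f = rename Subtype.val (pderiv (⟨w, hw⟩ : (f.vars : Set σ)) q) := by
      rw [← pderiv_rename Subtype.val_injective]
      rw [hq']
    rw [this]
    refine (vars_rename _ _).trans ?_
    intro x hx
    obtain ⟨y, -, rfl⟩ := Finset.mem_image.1 hx
    exact y.2
  · rw [pderiv_zero_of_notMem hw]
    simp

theorem vars_totalDer {K : Type*} [Field K] {n : ℕ} (δ : K → K)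
    (f : DPoly K n) (w : Fin n × ℕ) (hw : w ∈ (totalDer δ f).vars) :
    w ∈ f.vars ∨ ∃ u ∈ f.vars, w = (u.1, u.2 + 1) := by
  classical
  unfold totalDer at hw
  rcases Finset.mem_union.1 (vars_add_subset _ _ hw) with h | h
  · left
    unfold coeffDer at h
    obtain ⟨m, hm, hwm⟩ := Finset.mem_biUnion.1 (vars_sum_subset _ _ h)
    rw [mem_vars_iff_mem_support]
    refine ⟨m, hm, ?_⟩
    by_cases h0 : δ (coeff m f) = 0
    · rw [h0] at hwm; simp at hwm
    · rwa [vars_monomial h0] at hwm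
  · obtain ⟨u, hu, hwu⟩ := Finset.mem_biUnion.1 (vars_sum_subset _ _ h)
    rcases Finset.mem_union.1 (vars_mul _ _ hwu) with h | h
    · exact Or.inl (vars_pderiv_subset _ _ h)
    · rw [vars_X, Finset.mem_singleton] at h
      exact Or.inr ⟨u, hu, h⟩

theorem vars_iter_rk {K : Type*} [Field K] {n : ℕ} (δ : K → K)
    (f : DPoly K n) (c : Fin n) (o : ℕ) (hf : ∀ w ∈ f.vars, rkLE w (c, o)) (k : ℕ) :
    ∀ w ∈ ((totalDer δ)^[k] f).vars, rkLE w (c, o + k) := by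
  induction k with
  | zero => exact hf
  | succ k ih =>
    intro w hw
    rw [Function.iterate_succ_apply'] at hw
    rcases vars_totalDer δ _ w hw with h | ⟨u, hu, rfl⟩
    · rcases ih w h with h | ⟨h, h'⟩
      · exact Or.inl h
      · exact Or.inr ⟨h, by simp only at h' ⊢; omega⟩
    · rcases ih u hu with h | ⟨h, h'⟩
      · exact Or.inl h
      · exact Or.inr ⟨h, by simp only at h' ⊢; omega⟩

theorem vars_iter_ord {K : Type*} [Field K] {n : ℕ} (δ : K → K)
    (f : DPoly K n) (d : ℕ) (hf : ∀ w ∈ f.vars, w.2 ≤ d) (k : ℕ) :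
    ∀ w ∈ ((totalDer δ)^[k] f).vars, w.2 ≤ d + k := by
  induction k with
  | zero => exact hf
  | succ k ih =>
    intro w hw
    rw [Function.iterate_succ_apply'] at hw
    rcases vars_totalDer δ _ w hw with h | ⟨u, hu, rfl⟩
    · have := ih w h
      omega
    · have := ih u hu
      simp only
      omega

theorem pderiv_iter {K : Type*} [Field K] [CharZero K] {n : ℕ} (δ : Derivation ℚ K K)
    (f : DPoly K n) (c : Fin n) (o : ℕ) (hf : ∀ w ∈ f.vars, rkLE w (c, o)) (k : ℕ) :
    pderiv (c, o + k) ((totalDer δ)^[k] f) = pderiv (c, o) f := by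
  induction k with
  | zero => rfl
  | succ k ih =>
    rw [Function.iterate_succ_apply', ← add_assoc, pderiv_totalDer, ih, pderiv_zero_of_notMem,
      totalDer_zero, zero_add]
    intro h
    rcases vars_iter_rk δ f c o hf k _ h with h | ⟨-, h⟩
    · exact lt_irrefl _ h
    · simp only at h; omega

theorem diffSpan_isDiff {K : Type*} [Field K] [CharZero K] {n : ℕ} (δ : Derivation ℚ K K)
    (S : Set (DPoly K n)) : IsDiffIdeal δ (diffSpan δ S) := by
  intro f hf
  unfold diffSpan at hf ⊢
  induction hf using Submodule.span_induction with
  | mem x hx =>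
    obtain ⟨f, hf, k, rfl⟩ := hx
    exact Ideal.subset_span ⟨f, hf, k + 1, (Function.iterate_succ_apply' _ _ _).symm⟩
  | zero => rw [totalDer_zero]; exact Ideal.zero_mem _
  | add x y _ _ hx hy => rw [totalDer_add]; exact Ideal.add_mem _ hx hy
  | smul a x hx' hx =>
    rw [smul_eq_mul, totalDer_mul]
    exact Ideal.add_mem _ (Ideal.mul_mem_left _ _ hx) (Ideal.mul_mem_right _ _ hx')

theorem totalDer_pow_mul {K : Type*} [Field K] [CharZero K] {n : ℕ} (δ : Derivation ℚ K K)
    (a : DPoly K n) (d : ℕ) : ∃ b, a * totalDer δ (a ^ d) = b * a ^ d := by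
  induction d with
  | zero =>
    have h := totalDer_mul δ (1 : DPoly K n) 1
    have h1 : totalDer δ (1 : DPoly K n) = 0 := by simpa using h
    exact ⟨0, by simp [h1]⟩
  | succ d ih =>
    obtain ⟨b, hb⟩ := ih
    refine ⟨b + totalDer δ a, ?_⟩
    rw [pow_succ, totalDer_mul]
    linear_combination a * hb

theorem sat_isDiff {K : Type*} [Field K] [CharZero K] {n : ℕ} (δ : Derivation ℚ K K)
    (J : Ideal (DPoly K n)) (hJ : IsDiffIdeal δ J) (a : DPoly K n) :
    IsDiffIdeal δ (saturationBy J a) := by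
  rintro f ⟨d, hd⟩
  refine ⟨d + 1, ?_⟩
  obtain ⟨b, hb⟩ := totalDer_pow_mul δ a d
  have h1 := hJ _ hd
  rw [totalDer_mul] at h1
  have h2 : a ^ (d + 1) * totalDer δ f =
      a * (a ^ d * totalDer δ f + f * totalDer δ (a ^ d)) - b * (a ^ d * f) := by
    linear_combination (-f) * hb
  rw [h2]
  exact J.sub_mem (J.mul_mem_left _ h1) (J.mul_mem_left _ hd)

theorem minimalPrime_exists {R : Type*} [CommRing R] {I p : Ideal R} (hI : I.IsRadical)
    (hp : p ∈ I.minimalPrimes) {x : R} (hx : x ∈ p) : ∃ y ∉ p, y * x ∈ I := by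
  have hpp : p.IsPrime := hp.1.1
  by_contra! hcon
  let S : Submonoid R := p.primeCompl ⊔ Submonoid.powers x
  have hdisj : Disjoint (I : Set R) (S : Set R) := by
    rw [Set.disjoint_left]
    intro z hz hzS
    obtain ⟨y, hy, w, ⟨k, rfl⟩, rfl⟩ := Submonoid.mem_sup.1 hzS
    refine hcon y hy (hI ⟨k + 1, ?_⟩)
    have : (y * x) ^ (k + 1) = (y ^ k * x) * (y * x ^ k) := by ring
    rw [this]
    exact I.mul_mem_left _ hz
  obtain ⟨q, hq, hIq, hqS⟩ := Ideal.exists_le_prime_disjoint I S hdisj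
  have hqp : q ≤ p := by
    intro z hz
    by_contra hzp
    exact Set.disjoint_left.1 hqS hz (Submonoid.mem_sup_left hzp)
  have := hp.2 ⟨hq, hIq⟩ hqp hx
  exact Set.disjoint_left.1 hqS this (Submonoid.mem_sup_right (Submonoid.mem_powers x))

theorem minimalPrime_isDiff {K : Type*} [Field K] [CharZero K] {n : ℕ} (δ : Derivation ℚ K K)
    {I p : Ideal (DPoly K n)} (hI : I.IsRadical) (hd : IsDiffIdeal δ I)
    (hp : p ∈ I.minimalPrimes) : IsDiffIdeal δ p := by
  intro f hf
  have hpp : p.IsPrime := hp.1.1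
  obtain ⟨y, hy, hyf⟩ := minimalPrime_exists hI hp hf
  have h1 := hp.1.2 (hd _ hyf)
  rw [totalDer_mul] at h1
  have h2 : y * totalDer δ f ∈ p := by
    have := p.sub_mem h1 (p.mul_mem_right (totalDer δ y) hf)
    simpa using this
  exact (hpp.mem_or_mem h2).resolve_left hy

theorem minDiffPrime_minimal {K : Type*} [Field K] [CharZero K] {n : ℕ} (δ : Derivation ℚ K K)
    {I p : Ideal (DPoly K n)} (hI : I.IsRadical) (hd : IsDiffIdeal δ I)
    (hp : MinDiffPrimeOver δ I p) : p ∈ I.minimalPrimes := by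
  obtain ⟨h1, h2, h3, h4⟩ := hp
  obtain ⟨q, hq, hqp⟩ := Ideal.exists_minimalPrimes_le h3
  have := h4 q hq.1.1 (minimalPrime_isDiff δ hI hd hq) hq.1.2 hqp
  rwa [← this]

end DTri

namespace DTri

open MvPolynomial

theorem isAlgebraic_of_pderiv {K τ A : Type*} [Field K] [CommRing A] [Algebra K A]
    (l : τ) (x : τ → A) (g : MvPolynomial τ K) (h0 : aeval x g = 0)
    (h1 : aeval x (pderiv l g) ≠ 0) :
    IsAlgebraic (Algebra.adjoin K (x '' {l}ᶜ)) (x l) := by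
  classical
  set B := Algebra.adjoin K (x '' {l}ᶜ)
  let z : τ → Polynomial B := fun w => if h : w = l then Polynomial.X else
    Polynomial.C ⟨x w, Algebra.subset_adjoin ⟨w, h, rfl⟩⟩
  let Ψ : MvPolynomial τ K →ₐ[K] Polynomial B := aeval z
  have hz : ∀ w, Polynomial.aeval (x l) (z w) = x w := by
    intro w
    by_cases h : w = l
    · simp [z, h]
    · simp only [z, h, dite_false, Polynomial.aeval_C]
      rfl
  have hev : ∀ f, Polynomial.aeval (x l) (Ψ f) = aeval x f := by
    intro f
    induction f using MvPolynomial.induction_on with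
    | C a =>
      simp only [Ψ, aeval_C]
      rw [IsScalarTower.algebraMap_apply K B (Polynomial B), ← Polynomial.C_eq_algebraMap,
        Polynomial.aeval_C, ← IsScalarTower.algebraMap_apply K B A]
    | add p q hp hq => simp only [map_add, hp, hq]
    | mul_X p j hp =>
      simp only [map_mul, hp]
      congr 1
      simp only [Ψ, aeval_X, hz]
  have hder : ∀ f, Polynomial.derivative (Ψ f) = Ψ (pderiv l f) := by
    intro f
    induction f using MvPolynomial.induction_on with
    | C a =>
      simp only [Ψ, aeval_C, pderiv_C, map_zero]
      rw [IsScalarTower.algebraMap_apply K B (Polynomial B), ← Polynomial.C_eq_algebraMap,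
        Polynomial.derivative_C]
    | add p q hp hq => simp only [map_add, hp, hq]
    | mul_X p j hp =>
      have hX : Ψ (X j) = z j := by simp [Ψ]
      have hzj : Polynomial.derivative (z j) = Ψ (pderiv l (X j)) := by
        by_cases h : j = l
        · subst h
          simp [z]
        · rw [pderiv_X_of_ne h]
          simp [z, h]
      rw [map_mul, Polynomial.derivative_mul, hp, hX, hzj, Derivation.leibniz, map_add,
        smul_eq_mul, smul_eq_mul, map_mul, map_mul, hX]
      ring
  refine ⟨Ψ g, ?_, ?_⟩
  · intro h
    apply h1
    rw [← hev, ← hder, h]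
    simp
  · rw [hev, h0]

theorem mem_closure_of_pderiv {K σ A : Type*} [Field K] [CommRing A] [IsDomain A] [Algebra K A]
    (l : σ) (x : σ → A) (g : MvPolynomial σ K) (h0 : aeval x g = 0)
    (h1 : aeval x (pderiv l g) ≠ 0) :
    x l ∈ (AlgebraicIndependent.matroid K A).closure (x '' {w | w ∈ g.vars ∧ w ≠ l}) := by
  classical
  have hl : l ∈ g.vars := by
    by_contra h
    rw [pderiv_zero_of_notMem h] at h1
    simp at h1
  obtain ⟨q, hq⟩ := exists_rename_eq_of_vars_subset_range g
      (Subtype.val : {w // w ∈ g.vars} → σ) Subtype.val_injective (by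
        intro w hw
        exact ⟨⟨w, hw⟩, rfl⟩)
  have h := isAlgebraic_of_pderiv (⟨l, hl⟩ : {w // w ∈ g.vars}) (x ∘ Subtype.val) q
    (by rw [← aeval_rename, hq, h0])
    (by
      rw [← aeval_rename, ← pderiv_rename Subtype.val_injective, hq]
      exact h1)
  rw [AlgebraicIndependent.matroid_closure_eq, SetLike.mem_coe, Subalgebra.mem_algebraicClosure]
  have hset : (x ∘ Subtype.val) '' {(⟨l, hl⟩ : {w // w ∈ g.vars})}ᶜ =
      x '' {w | w ∈ g.vars ∧ w ≠ l} := by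
    ext y
    constructor
    · rintro ⟨⟨w, hw⟩, hne, rfl⟩
      exact ⟨w, ⟨hw, fun h => hne (Subtype.ext h)⟩, rfl⟩
    · rintro ⟨w, ⟨hw, hne⟩, rfl⟩
      exact ⟨⟨w, hw⟩, fun h => hne (congrArg Subtype.val h), rfl⟩
  rw [hset] at h
  exact h

/-- The derivatives of order at most `m` which are not derivatives of a leader. -/
def lowSet {n r : ℕ} (cs : Fin r → Fin n) (os : Fin r → ℕ) (m : ℕ) : Set (Fin n × ℕ) :=
  {w | (∀ i k, w ≠ (cs i, os i + k)) ∧ w.2 ≤ m}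

theorem lowSet_mono {n r : ℕ} (cs : Fin r → Fin n) (os : Fin r → ℕ) {m m' : ℕ} (h : m ≤ m') :
    lowSet cs os m ⊆ lowSet cs os m' := fun _ hw => ⟨hw.1, hw.2.trans h⟩

theorem lowSet_encard {n r : ℕ} (cs : Fin r → Fin n) (hcs : StrictMono cs) (os : Fin r → ℕ)
    (m : ℕ) : (lowSet cs os m).encard ≤ ((n - r) * (m + 1) + ∑ i, os i : ℕ) := by
  classical
  let F : Finset (Fin n × ℕ) := ((Finset.univ \ Finset.univ.image cs) ×ˢ Finset.range (m + 1)) ∪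
    Finset.univ.biUnion (fun i => ({cs i} : Finset (Fin n)) ×ˢ Finset.range (os i))
  have hsub : lowSet cs os m ⊆ F := by
    rintro ⟨a, b⟩ ⟨h1, h2⟩
    simp only [F, Finset.coe_union, Set.mem_union, Finset.mem_coe]
    by_cases ha : ∃ i, cs i = a
    · obtain ⟨i, rfl⟩ := ha
      right
      refine Finset.mem_biUnion.2 ⟨i, Finset.mem_univ _, ?_⟩
      simp only [Finset.mem_product, Finset.mem_singleton, Finset.mem_range, true_and]
      by_contra hb
      apply h1 i (b - os i)
      ext <;> simp
      omega
    · left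
      simp only [Finset.mem_product, Finset.mem_sdiff, Finset.mem_univ, Finset.mem_image,
        true_and, Finset.mem_range]
      refine ⟨ha, ?_⟩
      simp only at h2
      omega
  refine (Set.encard_le_encard hsub).trans ?_
  rw [Set.encard_coe_eq_coe_finsetCard]
  norm_cast
  refine (Finset.card_union_le _ _).trans ?_
  refine add_le_add ?_ ?_
  · rw [Finset.card_product, Finset.card_range, Finset.card_sdiff_of_subset (Finset.subset_univ _),
      Finset.card_image_of_injective _ hcs.injective]
    simp
  · refine Finset.card_biUnion_le.trans ?_
    simp

theorem diffDim_eq {K : Type*} [Field K] {n r : ℕ} (cs : Fin r → Fin n) (hcs : StrictMono cs)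
    (os : Fin r → ℕ) (p : Ideal (DPoly K n)) (hp : p.IsPrime)
    (g : Fin r → ℕ → DPoly K n) (D : ℕ)
    (hg : ∀ i k, g i k ∈ p) (hgs : ∀ i k, pderiv (cs i, os i + k) (g i k) ∉ p)
    (hrk : ∀ i k, ∀ w ∈ (g i k).vars, rkLE w (cs i, os i + k))
    (hord : ∀ i k, ∀ w ∈ (g i k).vars, w.2 ≤ D + k)
    (hfree : ∀ f ∈ p, (∀ w ∈ f.vars, ∀ i k, w ≠ (cs i, os i + k)) → f = 0) :
    diffDim p = n - r := by
  classical
  let A := DPoly K n ⧸ p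
  have hdom : IsDomain A := Ideal.Quotient.isDomain p
  have hfaith : FaithfulSMul K A :=
    (faithfulSMul_iff_algebraMap_injective K A).2 (algebraMap K A).injective
  let x : Fin n × ℕ → A := fun w => Ideal.Quotient.mk p (X w)
  have hx : ∀ f : DPoly K n, aeval x f = Ideal.Quotient.mk p f := by
    intro f
    have : (aeval x : DPoly K n →ₐ[K] A) = Ideal.Quotient.mkₐ K p := by
      ext w
      simp only [aeval_X]
      rfl
    rw [this]
    rfl
  let M := AlgebraicIndependent.matroid K A
  have hsubcl : ∀ S : Set A, S ⊆ M.closure S := fun S =>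
    M.subset_closure S (by
      change S ⊆ (AlgebraicIndependent.matroid K A).E
      rw [AlgebraicIndependent.matroid_e]
      exact Set.subset_univ _)
  have hstep : ∀ (i : Fin r) (k : ℕ),
      x (cs i, os i + k) ∈ M.closure (x '' lowSet cs os (k + (i.1 + 1) * D)) := by
    suffices h : ∀ (a : ℕ) (i : Fin r), i.1 = a → ∀ k : ℕ,
        x (cs i, os i + k) ∈ M.closure (x '' lowSet cs os (k + (i.1 + 1) * D)) from
      fun i k => h i.1 i rfl k
    intro a
    induction a using Nat.strong_induction_on with
    | _ a iha =>
    intro i hia k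
    induction k using Nat.strong_induction_on with
    | _ k ihk =>
    have hmem := mem_closure_of_pderiv (cs i, os i + k) x (g i k)
      (by rw [hx, Ideal.Quotient.eq_zero_iff_mem]; exact hg i k)
      (by rw [hx, Ne, Ideal.Quotient.eq_zero_iff_mem]; exact hgs i k)
    refine M.closure_subset_closure_of_subset_closure ?_ hmem
    rintro _ ⟨w, ⟨hw, hne⟩, rfl⟩
    have hwo := hord i k w hw
    have hD : D ≤ (i.1 + 1) * D := Nat.le_mul_of_pos_left _ (Nat.succ_pos _)
    by_cases h : ∃ j l, w = (cs j, os j + l)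
    · obtain ⟨j, l, rfl⟩ := h
      simp only at hwo
      rcases hrk i k _ hw with hlt | ⟨heq, hle⟩
      · have hji : j < i := hcs.lt_iff_lt.1 hlt
        have h1 := iha j.1 (by rw [← hia]; exact hji) j rfl l
        refine M.closure_subset_closure (Set.image_mono (lowSet_mono cs os ?_)) h1
        have h2 : (j.1 + 1 + 1) * D ≤ (i.1 + 1) * D :=
          Nat.mul_le_mul_right _ (by have : j.1 < i.1 := hji; omega)
        rw [Nat.add_mul (j.1 + 1) 1 D] at h2
        omega
      · have hji : j = i := hcs.injective heq
        subst hji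
        simp only at hle
        have hlk : l < k := by
          rcases Nat.lt_or_ge l k with h | h
          · exact h
          · exfalso
            apply hne
            have : l = k := by omega
            rw [this]
        refine M.closure_subset_closure (Set.image_mono (lowSet_mono cs os ?_)) (ihk l hlk)
        omega
    · push Not at h
      exact hsubcl _ ⟨w, ⟨h, by omega⟩, rfl⟩
  have hall : ∀ (N : ℕ) (w : Fin n × ℕ), w.2 ≤ N →
      x w ∈ M.closure (x '' lowSet cs os (N + (r + 1) * D)) := by
    intro N w hw
    by_cases h : ∃ i k, w = (cs i, os i + k)
    · obtain ⟨i, k, rfl⟩ := h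
      refine M.closure_subset_closure (Set.image_mono (lowSet_mono cs os ?_)) (hstep i k)
      have h1 : (i.1 + 1) * D ≤ (r + 1) * D := Nat.mul_le_mul_right _ (by omega)
      simp only at hw
      omega
    · push Not at h
      exact hsubcl _ ⟨w, ⟨h, by omega⟩, rfl⟩
  unfold diffDim
  apply le_antisymm
  · apply csSup_le'
    rintro _ ⟨s, rfl, hs⟩
    by_contra! hlt
    -- the family is algebraically independent
    have hind : AlgebraicIndependent K (fun w : {w : Fin n × ℕ // w.1 ∈ s} => x w.1) := by
      rw [algebraicIndependent_iff]
      intro q hq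
      have h1 : aeval x (rename Subtype.val q) = 0 := by
        rw [aeval_rename]
        exact hq
      rw [hx, Ideal.Quotient.eq_zero_iff_mem] at h1
      have h2 := hs _ h1 (by
        intro v hv
        obtain ⟨y, -, rfl⟩ := Finset.mem_image.1 (vars_rename _ _ hv)
        exact y.2)
      exact rename_injective _ Subtype.val_injective (by rw [h2, map_zero])
    let N := (n - r) * ((r + 1) * D) + ∑ i, os i
    let W : Set (Fin n × ℕ) := (s ×ˢ Finset.range (N + 1) : Finset (Fin n × ℕ))
    have hWs : ∀ w ∈ W, w.1 ∈ s ∧ w.2 ≤ N := by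
      intro w hw
      simp only [W, Finset.mem_coe, Finset.mem_product, Finset.mem_range] at hw
      exact ⟨hw.1, by omega⟩
    have hinj : Set.InjOn x W := by
      intro a ha b hb hab
      have := hind.injective (a₁ := ⟨a, (hWs a ha).1⟩) (a₂ := ⟨b, (hWs b hb).1⟩) hab
      exact congrArg Subtype.val this
    have hMind : M.Indep (x '' W) := by
      apply AlgebraicIndependent.matroid_indep_iff.2
      have h1 := hind.to_subtype_range
      refine AlgebraicIndependent.mono ?_ h1
      rintro _ ⟨w, hw, rfl⟩
      exact ⟨⟨w, (hWs w hw).1⟩, rfl⟩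
    have hle : (x '' W).encard ≤ (lowSet cs os (N + (r + 1) * D)).encard := by
      rw [← hMind.eRk_eq_encard]
      calc M.eRk (x '' W) ≤ M.eRk (M.closure (x '' lowSet cs os (N + (r + 1) * D))) := by
            apply M.eRk_mono
            rintro _ ⟨w, hw, rfl⟩
            exact hall N w (hWs w hw).2
        _ = M.eRk (x '' lowSet cs os (N + (r + 1) * D)) := M.eRk_closure_eq _
        _ ≤ (x '' lowSet cs os (N + (r + 1) * D)).encard := M.eRk_le_encard _
        _ ≤ _ := Set.encard_image_le _ _
    rw [hinj.encard_image] at hle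
    have hle2 := hle.trans (lowSet_encard cs hcs os _)
    rw [Set.encard_coe_eq_coe_finsetCard, Finset.card_product, Finset.card_range] at hle2
    norm_cast at hle2
    have h3 : (n - r + 1) * (N + 1) ≤ s.card * (N + 1) := Nat.mul_le_mul_right _ hlt
    have h4 := h3.trans hle2
    have h5 : N = (n - r) * ((r + 1) * D) + ∑ i, os i := rfl
    nlinarith
  · apply le_csSup
    · refine ⟨n, ?_⟩
      rintro _ ⟨s, rfl, -⟩
      simpa using Finset.card_le_univ s
    · refine ⟨Finset.univ \ Finset.univ.image cs, ?_, ?_⟩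
      · rw [Finset.card_sdiff_of_subset (Finset.subset_univ _),
          Finset.card_image_of_injective _ hcs.injective]
        simp
      · intro f hf hv
        refine hfree f hf ?_
        rintro w hw i k rfl
        have := hv _ hw
        simp at this

end DTri

open DTri in
/-- If `T` is a saturated differential triangular set in `K{y_1,…,y_n}`, then `dsat(T)` is
an unmixed radical differential ideal. -/
theorem dsat_isRadical_unmixed
    {K : Type*} [Field K] [CharZero K] (δK : Derivation ℚ K K) {n r : ℕ}
    (T : Fin r → DPoly K n) (cs : Fin r → Fin n) (os : Fin r → ℕ)
    (hT : DSaturated ⇑δK T cs os) :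
    (dsat ⇑δK T cs os).IsRadical ∧
    IsDiffIdeal ⇑δK (dsat ⇑δK T cs os) ∧
    DiffUnmixed ⇑δK (dsat ⇑δK T cs os) := by
  classical
  obtain ⟨⟨⟨hcs, hlead⟩, -⟩, -⟩ := hT
  have hvars : ∀ i, ∀ w ∈ (T i).vars, rkLE w (cs i, os i) := fun i => (hlead i).2
  set H := initSepProd T cs os with hH
  let v : Fin r ×ₗ ℕ → Fin n × ℕ := fun a => (cs (ofLex a).1, os (ofLex a).1 + (ofLex a).2)
  let g : Fin r ×ₗ ℕ → DPoly K n := fun a => (totalDer δK)^[(ofLex a).2] (T (ofLex a).1)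
  have hspan : diffSpan δK (Set.range T) = Ideal.span (Set.range g) := by
    unfold diffSpan
    congr 1
    ext f
    constructor
    · rintro ⟨_, ⟨i, rfl⟩, k, rfl⟩
      exact ⟨toLex (i, k), rfl⟩
    · rintro ⟨a, rfl⟩
      exact ⟨_, ⟨(ofLex a).1, rfl⟩, (ofLex a).2, rfl⟩
  have hv : Function.Injective v := by
    intro a b hab
    have h1 : (ofLex a).1 = (ofLex b).1 := hcs.injective (congrArg Prod.fst hab)
    have h2 : os (ofLex a).1 + (ofLex a).2 = os (ofLex b).1 + (ofLex b).2 :=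
      congrArg Prod.snd hab
    rw [h1] at h2
    exact ofLex.injective (Prod.ext h1 (by omega))
  have hsepH : ∀ i, MvPolynomial.pderiv (cs i, os i) (T i) ∣ H := by
    intro i
    rw [hH, initSepProd]
    exact Dvd.dvd.mul_left (Finset.dvd_prod_of_mem
      (fun j => MvPolynomial.pderiv (cs j, os j) (T j)) (Finset.mem_univ i)) _
  have htri : ∀ a b, b < a → MvPolynomial.pderiv (v a) (g b) = 0 := by
    intro a b hab
    apply pderiv_zero_of_notMem
    intro hmem
    have h1 := vars_iter_rk δK (T (ofLex b).1) _ _ (hvars _) (ofLex b).2 _ hmem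
    rcases Prod.Lex.lt_iff.1 hab with h | ⟨h, h'⟩
    · have h2 := hcs h
      rcases h1 with h1 | ⟨h1, -⟩
      · exact lt_asymm h1 h2
      · exact absurd h1 h2.ne'
    · rcases h1 with h1 | ⟨-, h1⟩
      · simp only [v, h] at h1
        exact lt_irrefl _ h1
      · simp only [v, h] at h1
        omega
  have hsep : ∀ a, MvPolynomial.pderiv (v a) (g a) ∣ H := by
    intro a
    have := pderiv_iter δK (T (ofLex a).1) _ _ (hvars _) (ofLex a).2
    change MvPolynomial.pderiv (v a) (g a) = _ at this
    rw [this]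
    exact hsepH _
  obtain ⟨hrad, htf⟩ := DTri.lazard v hv g H htri hsep
  have hdsat : dsat δK T cs os = saturationBy (Ideal.span (Set.range g)) H := by
    rw [dsat, hspan]
  have hdiff : IsDiffIdeal δK (dsat δK T cs os) :=
    sat_isDiff δK _ (diffSpan_isDiff δK _) _
  rw [← hdsat] at hrad htf
  refine ⟨hrad, hdiff, ?_⟩
  have hdim : ∀ p, MinDiffPrimeOver δK (dsat δK T cs os) p → diffDim p = n - r := by
    intro p hp
    have hmin := minDiffPrime_minimal δK hrad hdiff hp
    have hHp : H ∉ p := by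
      intro h
      obtain ⟨y, hy, hHy⟩ := Ideal.exists_mul_mem_of_mem_minimalPrimes hmin h
      apply hy
      obtain ⟨d, hd⟩ := hHy
      refine ⟨d + 1, ?_⟩
      have h2 : initSepProd T cs os ^ (d + 1) * y = initSepProd T cs os ^ d * (H * y) := by
        rw [hH]; ring
      rw [h2]
      exact hd
    have hgp : ∀ a, g a ∈ p := by
      intro a
      apply hmin.1.2
      rw [hdsat]
      refine ⟨0, ?_⟩
      rw [pow_zero, one_mul]
      exact Ideal.subset_span (Set.mem_range_self a)
    refine diffDim_eq cs hcs os p hp.1 (fun i k => g (toLex (i, k)))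
      (Finset.univ.sup fun i => ordTot (T i)) (fun i k => hgp _) ?_ ?_ ?_ ?_
    · intro i k hmem
      exact hHp (Ideal.mem_of_dvd _ (hsep (toLex (i, k))) hmem)
    · intro i k
      exact vars_iter_rk δK (T i) _ _ (hvars i) k
    · intro i k
      refine vars_iter_ord δK (T i) _ ?_ k
      intro w hw
      refine le_trans ?_ (Finset.le_sup (f := fun i => ordTot (T i)) (Finset.mem_univ i))
      exact Finset.le_sup (f := fun v : Fin n × ℕ => v.2) hw
    · intro f hf hfv
      by_contra hf0
      obtain ⟨y, hy, hfy⟩ := Ideal.exists_mul_mem_of_mem_minimalPrimes hmin hf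
      refine hy (htf f y hf0 ?_ hfy)
      rintro w hw ⟨a, rfl⟩
      exact hfv _ hw (ofLex a).1 (ofLex a).2 rfl
  intro p q hp hq
  rw [hdim p hp, hdim q hq]
end

section
/- For any polynomials h_1,...,h_k ∈ K[x_1,...,x_n], there exist finitely many pairs (A_q, D_q) (1 ≤ q ≤ N), where A_q = {Ψ_{q,1},...,Ψ_{q,l_q}} is a regular triangular set and D_q ∈ K[x_1,...,x_n], such that Zero(h_1,...,h_k) = ⋃_{q=1}^{N} Zero(sat(A_q)), and for each q: Zero(sat(A_q)) equals the Zariski closure of Zero(A_q/D_q), and the initial ini(Ψ_{q,i}) is nonzero at every point of Zero(A_q/D_q) for each 1 ≤ i ≤ l_q. -/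
open MvPolynomial

namespace Tri

/-- The initial of `f` with respect to the variable `i`: the leading coefficient of `f`
viewed as a univariate polynomial in `x_i`, expressed as a polynomial in the remaining
variables (an element of the same ring). -/
noncomputable def initial {K : Type*} [CommSemiring K] {σ : Type*} [DecidableEq σ]
    (f : MvPolynomial σ K) (i : σ) : MvPolynomial σ K :=
  ∑ m ∈ f.support.filter (fun m => m i = MvPolynomial.degreeOf i f),
    MvPolynomial.monomial (Finsupp.erase i m) (MvPolynomial.coeff m f)

/-- `x_i` is the leading variable of `f`: it occurs in `f` and is the greatest variable
occurring in `f`. -/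
def IsLeadingVar {K : Type*} [CommSemiring K] {n : ℕ} (f : MvPolynomial (Fin n) K)
    (i : Fin n) : Prop :=
  0 < MvPolynomial.degreeOf i f ∧ ∀ j, 0 < MvPolynomial.degreeOf j f → j ≤ i

/-- `T` (with leading variables `lvs`) is a triangular set: the polynomials of `T` are
nonconstant with pairwise distinct, increasing leading variables. -/
def IsTriangular {K : Type*} [CommSemiring K] {n r : ℕ} (T : Fin r → MvPolynomial (Fin n) K)
    (lvs : Fin r → Fin n) : Prop :=
  StrictMono lvs ∧ ∀ j, IsLeadingVar (T j) (lvs j)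

/-- `p` lies in `K[u]` where `u` is the parameter set of a triangular set with leading
variables `lvs`, i.e. no variable of `p` is a leading variable. -/
def inParams {K : Type*} [CommSemiring K] {n r : ℕ} (lvs : Fin r → Fin n)
    (p : MvPolynomial (Fin n) K) : Prop :=
  ∀ i ∈ p.vars, i ∉ Set.range lvs

/-- `T` is a regular triangular set: it is triangular, and for each `i` the ideal
`(T_1, …, T_{i-1}, ini(T_i))` has nonzero intersection with `K[u]`. -/
def IsRegular {K : Type*} [CommRing K] {n r : ℕ} (T : Fin r → MvPolynomial (Fin n) K)
    (lvs : Fin r → Fin n) : Prop :=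
  IsTriangular T lvs ∧
    ∀ i : Fin r, ∃ p ∈ Ideal.span (T '' {j | j < i} ∪ {initial (T i) (lvs i)}),
      p ≠ 0 ∧ inParams lvs p

/-- The product of the initials of a triangular set. -/
noncomputable def initProd {K : Type*} [CommSemiring K] {n r : ℕ}
    (T : Fin r → MvPolynomial (Fin n) K) (lvs : Fin r → Fin n) : MvPolynomial (Fin n) K :=
  ∏ j, initial (T j) (lvs j)

/-- The saturation `{f | ∃ d, a ^ d * f ∈ J}` of an ideal `J` by an element `a`. -/
def saturationBy {R : Type*} [CommRing R] (J : Ideal R) (a : R) : Ideal R where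
  carrier := {f | ∃ d : ℕ, a ^ d * f ∈ J}
  zero_mem' := ⟨0, by simpa using J.zero_mem⟩
  add_mem' := by
    rintro f g ⟨d1, h1⟩ ⟨d2, h2⟩
    refine ⟨d1 + d2, ?_⟩
    have h : a ^ (d1 + d2) * (f + g)
        = a ^ d2 * (a ^ d1 * f) + a ^ d1 * (a ^ d2 * g) := by ring
    rw [h]
    exact J.add_mem (J.mul_mem_left _ h1) (J.mul_mem_left _ h2)
  smul_mem' := by
    rintro c f ⟨d, h⟩
    exact ⟨d, by rw [smul_eq_mul, mul_left_comm]; exact J.mul_mem_left c h⟩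

/-- The saturation ideal `sat(T) = {f | ∃ d, I_T ^ d * f ∈ (T)}` of a triangular set. -/
noncomputable def satIdeal {K : Type*} [CommRing K] {n r : ℕ}
    (T : Fin r → MvPolynomial (Fin n) K) (lvs : Fin r → Fin n) :
    Ideal (MvPolynomial (Fin n) K) :=
  saturationBy (Ideal.span (Set.range T)) (initProd T lvs)

/-- The zero set `Zero(S/D)` in `E^n` of a system `S` of polynomials together with an
inequation `D ≠ 0`. -/
def zeroSet {K : Type*} [CommSemiring K] {n : ℕ} (E : Type*) [CommSemiring E] [Algebra K E]
    (S : Set (MvPolynomial (Fin n) K)) (D : MvPolynomial (Fin n) K) : Set (Fin n → E) :=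
  {x | (∀ f ∈ S, MvPolynomial.aeval x f = 0) ∧ MvPolynomial.aeval x D ≠ 0}

/-- The zero set `Zero(S)` in `E^n` of a system `S` of polynomials. -/
def zeroSet0 {K : Type*} [CommSemiring K] {n : ℕ} (E : Type*) [CommSemiring E] [Algebra K E]
    (S : Set (MvPolynomial (Fin n) K)) : Set (Fin n → E) :=
  {x | ∀ f ∈ S, MvPolynomial.aeval x f = 0}

/-- The zero set `Zero(I)` in `E^n` of an ideal `I`. -/
def zeroSetI {K : Type*} [CommSemiring K] {n : ℕ} (E : Type*) [CommSemiring E] [Algebra K E]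
    (I : Ideal (MvPolynomial (Fin n) K)) : Set (Fin n → E) :=
  {x | ∀ f ∈ I, MvPolynomial.aeval x f = 0}

/-- The Zariski closure in `E^n` of a set `S` (with respect to polynomials over `K`):
the zero set of all polynomials vanishing identically on `S`. -/
def zClosure (K : Type*) [CommSemiring K] {n : ℕ} {E : Type*} [CommSemiring E] [Algebra K E]
    (S : Set (Fin n → E)) : Set (Fin n → E) :=
  {x | ∀ f : MvPolynomial (Fin n) K, (∀ y ∈ S, MvPolynomial.aeval y f = 0) →
    MvPolynomial.aeval x f = 0}

/-- `P` is not identically zero on any irreducible component of `Zero(I)`; algebraically,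
`P` lies in no minimal prime of `I`. -/
def NotIdZeroOnComponents {R : Type*} [CommRing R] (I : Ideal R) (P : R) : Prop :=
  ∀ p ∈ I.minimalPrimes, P ∉ p

/-- An ideal is unmixed if all of its associated primes have the same dimension. -/
def IsUnmixed {R : Type*} [CommRing R] (I : Ideal R) : Prop :=
  ∀ p ∈ associatedPrimes R (R ⧸ I), ∀ q ∈ associatedPrimes R (R ⧸ I),
    ringKrullDim (R ⧸ p) = ringKrullDim (R ⧸ q)

end Tri

namespace TriAux

open Tri

variable {K : Type*} [Field K] {n : ℕ}

/-- View `f` as a univariate polynomial in `x_i` with coefficients in the same ring. -/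
noncomputable def phi (i : Fin n) :
    MvPolynomial (Fin n) K →ₐ[K] Polynomial (MvPolynomial (Fin n) K) :=
  MvPolynomial.aeval (fun j => if j = i then Polynomial.X else Polynomial.C (X j))

lemma eval_phi (i : Fin n) (f : MvPolynomial (Fin n) K) :
    Polynomial.aeval (X i : MvPolynomial (Fin n) K) (phi i f) = f := by
  have : ((Polynomial.aeval (R := MvPolynomial (Fin n) K)
      (X i : MvPolynomial (Fin n) K)).restrictScalars K).comp (phi i) = AlgHom.id K _ := by
    apply MvPolynomial.algHom_ext
    intro j
    by_cases h : j = i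
    · subst h; simp [phi]
    · simp [phi, h]
  exact DFunLike.congr_fun this f

lemma phi_injective (i : Fin n) : Function.Injective (phi (K := K) i) := by
  intro f g h
  rw [← eval_phi i f, h, eval_phi]

lemma phi_X (i : Fin n) : phi (K := K) i (X i) = Polynomial.X := by simp [phi]

lemma phi_of_mem (i : Fin n) {s : Set (Fin n)} (hs : i ∉ s) {f : MvPolynomial (Fin n) K}
    (hf : f ∈ supported K s) : phi i f = Polynomial.C f := by
  induction hf using Algebra.adjoin_induction with
  | mem x hx =>
    obtain ⟨j, hj, rfl⟩ := hx
    have : j ≠ i := fun h => hs (h ▸ hj)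
    simp [phi, this]
  | algebraMap r => 
    rw [AlgHom.commutes]; rfl
  | add x y _ _ hx hy => simp [hx, hy]
  | mul x y _ _ hx hy => simp [hx, hy]

lemma vars_monomial_subset {m : Fin n →₀ ℕ} {c : K} : (monomial m c).vars ⊆ m.support := by
  by_cases hc : c = 0
  · simp [hc]
  · rw [vars_monomial hc]

lemma isAlgebraic_of_root {U S : Type*} [CommRing U] [IsDomain U] [CommRing S] [IsDomain S]
    [Algebra U S] (p : Polynomial S) (hp0 : p ≠ 0) (hp : ∀ k, IsAlgebraic U (p.coeff k)) (x : S)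
    (hx : p.eval x = 0) : IsAlgebraic U x := by
  let B := Subalgebra.algebraicClosure U S
  have hl : p ∈ Polynomial.lifts (algebraMap B S) := by
    rw [Polynomial.lifts_iff_coeff_lifts]
    intro k
    exact ⟨⟨_, hp k⟩, rfl⟩
  obtain ⟨q, hq⟩ := (Polynomial.mem_lifts _).1 hl
  have : IsAlgebraic B x := by
    refine ⟨q, ?_, ?_⟩
    · rintro rfl
      exact hp0 (by rw [← hq, Polynomial.map_zero])
    · rw [Polynomial.aeval_def, Polynomial.eval₂_eq_eval_map, hq, hx]
  have hBalg : Algebra.IsAlgebraic U B :=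
    (Subalgebra.isAlgebraic_iff B).1 (fun x hx => hx)
  exact this.restrictScalars U

lemma phi_monomial (i : Fin n) (m : Fin n →₀ ℕ) (c : K) :
    phi i (monomial m c) = Polynomial.monomial (m i) (monomial (Finsupp.erase i m) c) := by
  have h1 : monomial m c = monomial (Finsupp.erase i m) c * X i ^ (m i) := by
    rw [X_pow_eq_monomial, monomial_mul, mul_one, Finsupp.erase_add_single]
  have h2 : monomial (Finsupp.erase i m) c ∈ supported K ({i}ᶜ : Set (Fin n)) := by
    rw [mem_supported]
    intro j hj
    have := vars_monomial_subset hj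
    simp at this
    simpa using this.1
  rw [h1, map_mul, map_pow, phi_X, phi_of_mem i (by simp) h2, Polynomial.C_mul_X_pow_eq_monomial]

lemma coeff_phi (i : Fin n) (f : MvPolynomial (Fin n) K) (k : ℕ) :
    (phi i f).coeff k = ∑ m ∈ f.support.filter (fun m => m i = k),
      monomial (Finsupp.erase i m) (coeff m f) := by
  conv_lhs => rw [f.as_sum]
  rw [map_sum, Polynomial.finsetSum_coeff, Finset.sum_filter]
  refine Finset.sum_congr rfl fun m _ => ?_
  rw [phi_monomial, Polynomial.coeff_monomial]

lemma natDegree_phi (i : Fin n) (f : MvPolynomial (Fin n) K) :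
    (phi i f).natDegree = degreeOf i f := by
  by_cases hf : f = 0
  · simp [hf]
  apply le_antisymm
  · rw [Polynomial.natDegree_le_iff_coeff_eq_zero]
    intro k hk
    rw [coeff_phi]
    apply Finset.sum_eq_zero
    intro m hm
    rw [Finset.mem_filter] at hm
    have := monomial_le_degreeOf i hm.1
    omega
  · obtain ⟨m, hm, hm'⟩ := Finset.exists_mem_eq_sup f.support (support_nonempty.2 hf) (fun m => m i)
    rw [← degreeOf_eq_sup] at hm'
    apply Polynomial.le_natDegree_of_ne_zero
    intro h0
    have h1 := congrArg (coeff (Finsupp.erase i m)) h0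
    rw [coeff_phi, coeff_sum, Finset.sum_eq_single m] at h1
    · simp at h1
      simp [h1] at hm
    · intro b hb hbm
      rw [coeff_monomial, if_neg]
      intro hh
      apply hbm
      rw [Finset.mem_filter] at hb
      rw [← Finsupp.erase_add_single i b, ← Finsupp.erase_add_single i m, hh, hb.2, hm']
    · intro hh
      exact absurd (Finset.mem_filter.2 ⟨hm, hm'.symm⟩) hh

lemma initial_eq (i : Fin n) (f : MvPolynomial (Fin n) K) :
    initial f i = (phi i f).leadingCoeff := by
  rw [Polynomial.leadingCoeff, natDegree_phi, coeff_phi, initial]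

lemma coeff_phi_mem (i : Fin n) {s : Set (Fin n)} {f : MvPolynomial (Fin n) K}
    (hf : f ∈ supported K s) (k : ℕ) : (phi i f).coeff k ∈ supported K (s \ {i}) := by
  rw [coeff_phi]
  refine Subalgebra.sum_mem _ fun m hm => ?_
  rw [Finset.mem_filter] at hm
  rw [mem_supported] at hf ⊢
  intro j hj
  have h1 := vars_monomial_subset hj
  simp at h1
  refine ⟨hf ?_, h1.1⟩
  simp only [Finset.mem_coe, mem_vars]
  exact ⟨m, hm.1, by simpa using h1.2⟩

/-- variables of index less than `m` -/
abbrev lo (n m : ℕ) : Set (Fin n) := {j | j.val < m}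

/-- `f` is an algebraic relation for `x_i` over the previous variables modulo `P`. -/
def W (P : Ideal (MvPolynomial (Fin n) K)) (i : Fin n) (f : MvPolynomial (Fin n) K) : Prop :=
  f ∈ P ∧ f ∈ supported K (lo n (i + 1)) ∧ (phi i f).leadingCoeff ∉ P

/-- the algebraic variables modulo `P` -/
def Y (P : Ideal (MvPolynomial (Fin n) K)) : Set (Fin n) := {i | ∃ f, W P i f}

lemma lo_diff (i : Fin n) : lo n (i + 1) \ {i} = lo n i := by
  ext j
  simp [Fin.ext_iff]
  omega

lemma W.pos {P : Ideal (MvPolynomial (Fin n) K)} {i : Fin n} {f : MvPolynomial (Fin n) K}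
    (h : W P i f) : 0 < degreeOf i f := by
  rw [← natDegree_phi]
  by_contra h0
  have h0 : (phi i f).natDegree = 0 := by omega
  have h1 := Polynomial.eq_C_of_natDegree_eq_zero h0
  have h2 := eval_phi i f
  rw [h1] at h2
  simp at h2
  apply h.2.2
  rw [Polynomial.leadingCoeff, h0, h2]
  exact h.1

lemma indep {P : Ideal (MvPolynomial (Fin n) K)} (hP : P.IsPrime) (m : ℕ)
    {r : MvPolynomial (Fin n) K} (hr : r ∈ P) (hr' : r ∈ supported K (lo n m \ Y P)) : r = 0 := by
  induction m generalizing r with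
  | zero =>
    have : lo n 0 \ Y P = ∅ := by ext j; simp
    rw [this, supported_empty, Algebra.mem_bot] at hr'
    obtain ⟨c, rfl⟩ := hr'
    by_contra h
    have hc : c ≠ 0 := by rintro rfl; simp at h
    exact hP.ne_top (Ideal.eq_top_of_isUnit_mem _ hr ((IsUnit.mk0 c hc).map _))
  | succ m ih =>
    by_cases hm : m < n
    · set i : Fin n := ⟨m, hm⟩
      by_cases hY : i ∈ Y P
      · apply ih hr
        refine supported_mono ?_ hr'
        rintro j ⟨h1, h2⟩
        refine ⟨?_, h2⟩
        have : j ≠ i := fun h => h2 (h ▸ hY)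
        simp [Fin.ext_iff, i] at this h1 ⊢
        omega
      · have h1 : (phi i r).leadingCoeff ∈ P := by
          by_contra h2
          exact hY ⟨r, hr, supported_mono Set.sdiff_subset hr', h2⟩
        have h3 := ih h1 (by
          refine supported_mono ?_ (coeff_phi_mem i hr' _)
          rintro j ⟨⟨h1, h2⟩, h3⟩
          refine ⟨?_, h2⟩
          simp [Fin.ext_iff, i] at h3 h1 ⊢
          omega)
        rw [Polynomial.leadingCoeff_eq_zero] at h3
        exact phi_injective i (by rw [h3, map_zero])
    · apply ih hr
      refine supported_mono ?_ hr'
      rintro j ⟨h1, h2⟩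
      exact ⟨by have := j.2; simp; omega, h2⟩

lemma isAlg {P : Ideal (MvPolynomial (Fin n) K)} (hP : P.IsPrime) (m : ℕ)
    (k : ℕ) (hk : k ≤ m) {c : MvPolynomial (Fin n) K} (hc : c ∈ supported K (lo n k)) :
    IsAlgebraic (supported K (lo n m \ Y P)) (Ideal.Quotient.mk P c) := by
  have : IsDomain (MvPolynomial (Fin n) K ⧸ P) := inferInstance
  set U := supported K (lo n m \ Y P) with hU
  have key : ∀ j : ℕ, ∀ i : Fin n, i.val = j → j < m →
      IsAlgebraic U (Ideal.Quotient.mk P (X i)) := by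
    intro j
    induction j using Nat.strong_induction_on with
    | _ j IH =>
    intro i hij hjm
    by_cases hY : i ∈ Y P
    · obtain ⟨f, hf1, hf2, hf3⟩ := hY
      have hB : ∀ c ∈ supported K (lo n i), IsAlgebraic U (Ideal.Quotient.mk P c) := by
        intro c hc
        induction hc using Algebra.adjoin_induction with
        | mem x hx =>
          obtain ⟨l, hl, rfl⟩ := hx
          exact IH l (by simpa [hij] using hl) l rfl (by simp at hl; omega)
        | algebraMap r => exact isAlgebraic_algebraMap (algebraMap K U r)
        | add x y _ _ hx hy => rw [map_add]; exact hx.add hy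
        | mul x y _ _ hx hy => rw [map_mul]; exact hx.mul hy
      refine isAlgebraic_of_root ((phi i f).map (Ideal.Quotient.mk P)) ?_ ?_ _ ?_
      · intro hp
        have := congrArg (fun q => Polynomial.coeff q (phi i f).natDegree) hp
        simp only [Polynomial.coeff_map, Polynomial.coeff_zero] at this
        exact hf3 (Ideal.Quotient.eq_zero_iff_mem.1 this)
      · intro k
        rw [Polynomial.coeff_map]
        have := coeff_phi_mem i hf2 k
        rw [lo_diff] at this
        exact hB _ this
      · rw [Polynomial.eval_map, Polynomial.eval₂_at_apply]
        have := eval_phi i f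
        rw [Polynomial.coe_aeval_eq_eval] at this
        rw [this]
        exact Ideal.Quotient.eq_zero_iff_mem.2 hf1
    · have : X i ∈ U := by
        rw [hU, X_mem_supported]
        exact ⟨by simp; omega, hY⟩
      exact isAlgebraic_algebraMap (⟨X i, this⟩ : U)
  induction hc using Algebra.adjoin_induction with
  | mem x hx =>
    obtain ⟨l, hl, rfl⟩ := hx
    exact key l l rfl (by simp at hl; omega)
  | algebraMap r => exact isAlgebraic_algebraMap (algebraMap K U r)
  | add x y _ _ hx hy => rw [map_add]; exact hx.add hy
  | mul x y _ _ hx hy => rw [map_mul]; exact hx.mul hy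

lemma norm_lemma {P : Ideal (MvPolynomial (Fin n) K)} (hP : P.IsPrime) (m : ℕ)
    {c : MvPolynomial (Fin n) K} (hc : c ∈ supported K (lo n m)) (hcP : c ∉ P) :
    ∃ a ∈ supported K (lo n m), ∃ q ∈ supported K (lo n m \ Y P), q ≠ 0 ∧ a * c - q ∈ P := by
  have halg := isAlg hP m m le_rfl hc
  have : IsDomain (MvPolynomial (Fin n) K ⧸ P) := inferInstance
  have h0 : Ideal.Quotient.mk P c ≠ 0 := by rwa [Ne, Ideal.Quotient.eq_zero_iff_mem]
  obtain ⟨p, hp0, hp⟩ :=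
    halg.exists_nonzero_coeff_and_aeval_eq_zero (mem_nonZeroDivisors_of_ne_zero h0)
  have hsub : supported K (lo n m \ Y P) ≤ supported K (lo n m) := supported_mono Set.sdiff_subset
  refine ⟨-(Polynomial.aeval c p.divX), ?_, p.coeff 0, (p.coeff 0).2, by simpa using hp0, ?_⟩
  · apply Subalgebra.neg_mem
    rw [Polynomial.aeval_eq_sum_range]
    refine Subalgebra.sum_mem _ fun j _ => ?_
    rw [Algebra.smul_def]
    exact Subalgebra.mul_mem _ (hsub (p.divX.coeff j).2) (Subalgebra.pow_mem _ hc _)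
  · rw [← Ideal.Quotient.eq_zero_iff_mem]
    have h1 : Polynomial.aeval (Ideal.Quotient.mk P c) p
        = Ideal.Quotient.mk P (Polynomial.aeval c p) := by
      have := Polynomial.aeval_algebraMap_apply (R := supported K (lo n m \ Y P))
        (MvPolynomial (Fin n) K ⧸ P) c p
      exact this
    rw [h1] at hp
    rw [← neg_eq_zero, ← map_neg, ← hp]
    congr 1
    conv_rhs => rw [← Polynomial.divX_mul_X_add p]
    simp only [map_add, map_mul, Polynomial.aeval_X, Polynomial.aeval_C]
    change _ = _ + (p.coeff 0 : MvPolynomial (Fin n) K)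
    ring

lemma exists_T {P : Ideal (MvPolynomial (Fin n) K)} (hP : P.IsPrime) (i : Fin n) (hi : i ∈ Y P) :
    ∃ T, W P i T ∧ (∀ f, W P i f → degreeOf i T ≤ degreeOf i f) ∧
      initial T i ∈ supported K (lo n i \ Y P) := by
  obtain ⟨f, hf, hmin⟩ : ∃ f, W P i f ∧ ∀ g, W P i g → degreeOf i f ≤ degreeOf i g := by
    classical
    have hex : ∃ d, ∃ f, W P i f ∧ degreeOf i f = d := by
      obtain ⟨f, hf⟩ := hi
      exact ⟨_, f, hf, rfl⟩
    obtain ⟨f, hf, hfd⟩ := Nat.find_spec hex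
    exact ⟨f, hf, fun g hg => hfd ▸ Nat.find_min' hex ⟨g, hg, rfl⟩⟩
  have hc : (phi i f).leadingCoeff ∈ supported K (lo n i) := by
    have := coeff_phi_mem i hf.2.1 (phi i f).natDegree
    rwa [lo_diff] at this
  obtain ⟨a, ha, q, hq, hq0, haq⟩ := norm_lemma hP i hc hf.2.2
  set c := (phi i f).leadingCoeff with hcdef
  set d := (phi i f).natDegree with hd
  set T := a * f - (a * c - q) * X i ^ d with hT
  have hlo : i ∉ lo n i := by simp
  have hsub : supported K (lo n i \ Y P) ≤ supported K (lo n i) := supported_mono Set.sdiff_subset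
  have hsub2 : supported K (lo n i) ≤ supported K (lo n (i + 1)) := supported_mono (by
    intro j hj; simp at hj ⊢; omega)
  have hphi : phi i T = Polynomial.C a * phi i f - Polynomial.C (a * c - q) * Polynomial.X ^ d := by
    rw [hT, map_sub, map_mul, map_mul, map_pow, phi_X, phi_of_mem i hlo ha, phi_of_mem i hlo
      (Subalgebra.sub_mem _ (Subalgebra.mul_mem _ ha hc) (hsub hq))]
  have hcoef : (phi i T).coeff d = q := by
    rw [hphi, Polynomial.coeff_sub, Polynomial.coeff_C_mul, Polynomial.coeff_C_mul,
      Polynomial.coeff_X_pow_self, hd, Polynomial.coeff_natDegree]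
    ring
  have hdeg : (phi i T).natDegree = d := by
    apply le_antisymm
    · rw [hphi]
      refine (Polynomial.natDegree_sub_le _ _).trans (max_le ?_ ?_)
      · exact Polynomial.natDegree_C_mul_le _ _
      · exact Polynomial.natDegree_C_mul_X_pow_le _ _
    · exact Polynomial.le_natDegree_of_ne_zero (by rw [hcoef]; exact hq0)
  have hlc : (phi i T).leadingCoeff = q := by rw [Polynomial.leadingCoeff, hdeg, hcoef]
  refine ⟨T, ⟨?_, ?_, ?_⟩, ?_, ?_⟩
  · exact P.sub_mem (P.mul_mem_left _ hf.1) (P.mul_mem_right _ haq)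
  · refine Subalgebra.sub_mem _ (Subalgebra.mul_mem _ (hsub2 ha) hf.2.1) (Subalgebra.mul_mem _
      (hsub2 (Subalgebra.sub_mem _ (Subalgebra.mul_mem _ ha hc) (hsub hq)))
      (Subalgebra.pow_mem _ ?_ _))
    rw [X_mem_supported]; simp
  · rw [hlc]
    intro h
    exact hq0 (indep hP i h hq)
  · intro g hg
    rw [← natDegree_phi, hdeg, hd, natDegree_phi]
    exact hmin g hg
  · rw [initial_eq, hlc]; exact hq

lemma mem_sat {P S : Ideal (MvPolynomial (Fin n) K)} (hP : P.IsPrime)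
    (T : Fin n → MvPolynomial (Fin n) K)
    (hT : ∀ i ∈ Y P, W P i (T i) ∧ (∀ f, W P i f → degreeOf i (T i) ≤ degreeOf i f))
    (hTS : ∀ i ∈ Y P, T i ∈ S)
    (hS : ∀ i ∈ Y P, ∀ f, initial (T i) i * f ∈ S → f ∈ S)
    (m : ℕ) {f : MvPolynomial (Fin n) K} (hf : f ∈ P) (hf' : f ∈ supported K (lo n m)) :
    f ∈ S := by
  induction m generalizing f with
  | zero =>
    have : lo n 0 = lo n 0 \ Y P := by ext j; simp
    rw [indep hP 0 hf (this ▸ hf')]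
    exact S.zero_mem
  | succ m ih =>
    by_cases hm : m < n
    swap
    · exact ih hf (supported_mono (by intro j hj; have := j.2; simp; omega) hf')
    obtain ⟨i, rfl⟩ : ∃ i : Fin n, i.val = m := ⟨⟨m, hm⟩, rfl⟩
    have hlo : i ∉ lo n i := by simp
    have hsub2 : supported K (lo n i) ≤ supported K (lo n (i + 1)) := supported_mono (by
      intro j hj; simp at hj ⊢; omega)
    have hX : (X i : MvPolynomial (Fin n) K) ∈ supported K (lo n (i + 1)) := by
      rw [X_mem_supported]; simp
    have hlcm : ∀ g ∈ supported K (lo n (i + 1)),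
        (phi i g).leadingCoeff ∈ supported K (lo n i) := by
      intro g hg
      have := coeff_phi_mem i hg (phi i g).natDegree
      rwa [lo_diff] at this
    generalize hd : (phi i f).degree = d
    induction d using WellFoundedLT.induction generalizing f with
    | ind d IH =>
    by_cases hf0 : f = 0
    · rw [hf0]; exact S.zero_mem
    have hp0 : phi i f ≠ 0 := fun h => hf0 (phi_injective i (by rw [h, map_zero]))
    set c := (phi i f).leadingCoeff with hc
    have hcm : c ∈ supported K (lo n i) := hlcm f hf'
    by_cases hcP : c ∈ P
    · have hcS := ih hcP hcm
      have h1 : f - c * X i ^ (phi i f).natDegree ∈ S := by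
        refine IH (phi i (f - c * X i ^ (phi i f).natDegree)).degree ?_
          (P.sub_mem hf (P.mul_mem_right _ hcP))
          (Subalgebra.sub_mem _ hf' (Subalgebra.mul_mem _ (hsub2 hcm)
            (Subalgebra.pow_mem _ hX _))) rfl
        rw [map_sub, map_mul, map_pow, phi_X, phi_of_mem i hlo hcm, hc,
          Polynomial.self_sub_C_mul_X_pow, ← hd]
        exact Polynomial.degree_eraseLead_lt hp0
      have := S.add_mem h1 (S.mul_mem_right (X i ^ (phi i f).natDegree) hcS)
      simpa using this
    · have hW : W P i f := ⟨hf, hf', hcP⟩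
      have hiY : i ∈ Y P := ⟨f, hW⟩
      obtain ⟨hTW, hTmin⟩ := hT i hiY
      have hle := hTmin f hW
      rw [← natDegree_phi, ← natDegree_phi] at hle
      apply hS i hiY
      rw [initial_eq]
      set b := (phi i (T i)).leadingCoeff with hb
      have hbm : b ∈ supported K (lo n i) := hlcm _ hTW.2.1
      have hb0 : b ≠ 0 := fun h => hTW.2.2 (by rw [← hb, h]; exact P.zero_mem)
      have hc0 : c ≠ 0 := fun h => hcP (by rw [h]; exact P.zero_mem)
      set e := (phi i f).natDegree - (phi i (T i)).natDegree with he
      have hT0 : phi i (T i) ≠ 0 := by rwa [← Polynomial.leadingCoeff_ne_zero]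
      have h1 : b * f - c * X i ^ e * T i ∈ S := by
        refine IH (phi i (b * f - c * X i ^ e * T i)).degree ?_
          (P.sub_mem (P.mul_mem_left _ hf) (P.mul_mem_left _ hTW.1))
          (Subalgebra.sub_mem _ (Subalgebra.mul_mem _ (hsub2 hbm) hf')
            (Subalgebra.mul_mem _ (Subalgebra.mul_mem _ (hsub2 hcm)
            (Subalgebra.pow_mem _ hX _)) hTW.2.1)) rfl
        rw [map_sub, map_mul, map_mul, map_mul, map_pow, phi_X, phi_of_mem i hlo hcm,
          phi_of_mem i hlo hbm]
        have hdb : (Polynomial.C b * phi i f).degree = (phi i f).degree :=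
          Polynomial.degree_C_mul hb0
        rw [← hd, ← hdb]
        apply Polynomial.degree_sub_lt_left
        · rw [hdb, Polynomial.degree_mul, Polynomial.degree_C_mul_X_pow _ hc0,
            Polynomial.degree_eq_natDegree hp0, Polynomial.degree_eq_natDegree hT0]
          norm_cast
          omega
        · exact mul_ne_zero (by simpa using hb0) hp0
        · rw [Polynomial.leadingCoeff_mul, Polynomial.leadingCoeff_mul,
            Polynomial.leadingCoeff_C, Polynomial.leadingCoeff_mul, Polynomial.leadingCoeff_C,
            Polynomial.leadingCoeff_X_pow, ← hb, ← hc]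
          ring
      have := S.add_mem h1 (S.mul_mem_left (c * X i ^ e) (hTS i hiY))
      simpa using this

lemma exists_for_prime {P : Ideal (MvPolynomial (Fin n) K)} (hP : P.IsPrime) :
    ∃ (r : ℕ) (A : Fin r → MvPolynomial (Fin n) K) (lvs : Fin r → Fin n),
      IsRegular A lvs ∧ satIdeal A lvs = P := by
  classical
  have hex : ∀ i : Fin n, ∃ T, i ∈ Y P → W P i T ∧
      (∀ f, W P i f → degreeOf i T ≤ degreeOf i f) ∧
      initial T i ∈ supported K (lo n i \ Y P) := by
    intro i
    by_cases hi : i ∈ Y P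
    · obtain ⟨T, hT⟩ := exists_T hP i hi
      exact ⟨T, fun _ => hT⟩
    · exact ⟨0, fun h => absurd h hi⟩
  choose T hT using hex
  let Yf : Finset (Fin n) := Finset.univ.filter (· ∈ Y P)
  let lvs : Fin Yf.card → Fin n := Yf.orderEmbOfFin rfl
  have hmem : ∀ j, lvs j ∈ Y P := fun j => by
    have := Finset.orderEmbOfFin_mem Yf rfl j
    exact (Finset.mem_filter.1 this).2
  have hrange : Set.range lvs = Y P := by
    rw [Finset.range_orderEmbOfFin]; ext; simp [Yf]
  have hsurj : ∀ i ∈ Y P, ∃ j, lvs j = i := fun i hi => by rwa [← hrange] at hi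
  have hiniP : ∀ i ∈ Y P, initial (T i) i ∉ P := fun i hi => by
    rw [initial_eq]; exact (hT i hi).1.2.2
  refine ⟨Yf.card, fun j => T (lvs j), lvs, ⟨⟨(Yf.orderEmbOfFin rfl).strictMono, ?_⟩, ?_⟩, ?_⟩
  · intro j
    refine ⟨(hT _ (hmem j)).1.pos, fun l hl => ?_⟩
    have h1 := (hT _ (hmem j)).1.2.1
    rw [mem_supported] at h1
    have h2 : l ∈ (T (lvs j)).vars := by
      rw [vars_def, Multiset.mem_toFinset, ← Multiset.count_pos, ← degreeOf_def]
      exact hl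
    have h3 := h1 h2
    simp at h3
    rw [Fin.le_def]; omega
  · intro j
    refine ⟨initial (T (lvs j)) (lvs j), Ideal.subset_span (Or.inr rfl), ?_, ?_⟩
    · intro h
      exact hiniP _ (hmem j) (by rw [h]; exact P.zero_mem)
    · intro i hi
      have := (hT _ (hmem j)).2.2
      rw [mem_supported] at this
      rw [hrange]
      exact (this hi).2
  · have hprod : initProd (fun j => T (lvs j)) lvs ∉ P := by
      rw [initProd, hP.prod_mem_iff]
      rintro ⟨j, -, hj⟩
      exact hiniP _ (hmem j) hj
    apply le_antisymm
    · rintro f ⟨d, hd⟩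
      have h1 : Ideal.span (Set.range fun j => T (lvs j)) ≤ P := by
        rw [Ideal.span_le]
        rintro _ ⟨j, rfl⟩
        exact (hT _ (hmem j)).1.1
      rcases hP.mem_or_mem (h1 hd) with h | h
      · exact absurd (hP.mem_of_pow_mem _ h) hprod
      · exact h
    · intro f hf
      refine mem_sat hP T (fun i hi => ⟨(hT i hi).1, (hT i hi).2.1⟩) ?_ ?_ n hf ?_
      · intro i hi
        obtain ⟨j, rfl⟩ := hsurj i hi
        exact ⟨0, by rw [pow_zero, one_mul]; exact Ideal.subset_span ⟨j, rfl⟩⟩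
      · rintro i hi g ⟨d, hd⟩
        obtain ⟨j, rfl⟩ := hsurj i hi
        refine ⟨d + 1, ?_⟩
        obtain ⟨z, hz⟩ : initial (T (lvs j)) (lvs j) ∣ initProd (fun j => T (lvs j)) lvs :=
          Finset.dvd_prod_of_mem (fun j => initial (T (lvs j)) (lvs j)) (Finset.mem_univ j)
        have : initProd (fun j => T (lvs j)) lvs ^ (d + 1) * g = z *
            (initProd (fun j => T (lvs j)) lvs ^ d * (initial (T (lvs j)) (lvs j) * g)) := by
          rw [pow_succ]
          nth_rewrite 2 [hz]
          ring
        rw [this]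
        exact Ideal.mul_mem_left _ _ hd
      · have : lo n n = Set.univ := by ext j; simp
        rw [this, supported_univ]; trivial

lemma closure_eq (E : Type*) [Field E] [IsAlgClosed E] [Algebra K E] {r : ℕ}
    (A : Fin r → MvPolynomial (Fin n) K) (lvs : Fin r → Fin n) :
    zeroSetI E (satIdeal A lvs) = zClosure K (zeroSet E (Set.range A) (initProd A lvs)) := by
  have hspan : ∀ y : Fin n → E, (∀ f ∈ Set.range A, aeval y f = 0) →
      ∀ f ∈ Ideal.span (Set.range A), aeval y f = 0 := by
    intro y hy
    have : Ideal.span (Set.range A) ≤ RingHom.ker (aeval (R := K) y) :=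
      Ideal.span_le.2 fun f hf => hy f hf
    exact fun f hf => this hf
  apply Set.Subset.antisymm
  · intro x hx f hf
    have h1 : initProd A lvs * f ∈ vanishingIdeal K
        (zeroLocus E (Ideal.span (Set.range A))) := by
      rw [mem_vanishingIdeal_iff]
      intro y hy
      rw [map_mul]
      by_cases h0 : aeval y (initProd A lvs) = 0
      · rw [h0, zero_mul]
      · rw [hf y ⟨fun g hg => hy g (Ideal.subset_span hg), h0⟩, mul_zero]
    rw [vanishingIdeal_zeroLocus_eq_radical] at h1
    obtain ⟨d, hd⟩ := h1
    rw [mul_pow] at hd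
    have := hx (f ^ d) ⟨d, hd⟩
    rw [map_pow] at this
    exact eq_zero_of_pow_eq_zero this
  · rintro x hx f ⟨d, hd⟩
    apply hx
    rintro y ⟨hy1, hy2⟩
    have := hspan y hy1 _ hd
    rw [map_mul, map_pow] at this
    exact (mul_eq_zero.1 this).resolve_left (pow_ne_zero _ hy2)

end TriAux

open Tri in
/-- Algebraic triangular decomposition: for polynomials `h_1, …, h_k` there are finitely
many pairs `(A_q, D_q)` with `A_q` regular triangular sets such that
`Zero(h_1,…,h_k) = ⋃_q Zero(sat(A_q))`, each `Zero(sat(A_q))` is the Zariski closure of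
`Zero(A_q/D_q)`, and the initials of the members of `A_q` do not vanish on
`Zero(A_q/D_q)`. -/
theorem exists_triangular_decomposition_pairs
    {K : Type*} [Field K] [CharZero K] (E : Type*) [Field E] [IsAlgClosed E] [Algebra K E]
    {n k : ℕ} (h : Fin k → MvPolynomial (Fin n) K) :
    ∃ (N : ℕ) (rr : Fin N → ℕ)
      (A : (q : Fin N) → Fin (rr q) → MvPolynomial (Fin n) K)
      (lvss : (q : Fin N) → Fin (rr q) → Fin n)
      (D : Fin N → MvPolynomial (Fin n) K),
      (∀ q, IsRegular (A q) (lvss q)) ∧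
      (zeroSet0 E (Set.range h) = ⋃ q, zeroSetI E (satIdeal (A q) (lvss q))) ∧
      (∀ q, zeroSetI E (satIdeal (A q) (lvss q))
          = zClosure K (zeroSet E (Set.range (A q)) (D q))) ∧
      (∀ q i, ∀ x ∈ zeroSet E (Set.range (A q)) (D q),
        MvPolynomial.aeval x (initial (A q i) (lvss q i)) ≠ 0) := by
  classical
  set I := Ideal.span (Set.range h) with hI
  have hfin := I.finite_minimalPrimes_of_isNoetherianRing
  let F := hfin.toFinset
  let e := F.equivFin.symm
  have hmin : ∀ q, (e q : Ideal _) ∈ I.minimalPrimes := fun q => hfin.mem_toFinset.1 (e q).2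
  have hex := fun q => TriAux.exists_for_prime (hmin q).1.1
  choose rr A lvss hreg hsat using hex
  refine ⟨F.card, rr, A, lvss, fun q => initProd (A q) (lvss q), hreg, ?_,
    fun q => TriAux.closure_eq E (A q) (lvss q), ?_⟩
  · ext x
    simp only [Set.mem_iUnion, hsat]
    constructor
    · intro hx
      have hle : I ≤ RingHom.ker (aeval (R := K) x) := Ideal.span_le.2 fun f hf => hx f hf
      have : (RingHom.ker (aeval (R := K) x)).IsPrime := RingHom.ker_isPrime _
      obtain ⟨p, hp, hpx⟩ := Ideal.exists_minimalPrimes_le hle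
      refine ⟨F.equivFin ⟨p, hfin.mem_toFinset.2 hp⟩, fun f hf => ?_⟩
      simp only [e, Equiv.symm_apply_apply] at hf
      exact hpx hf
    · rintro ⟨q, hq⟩ f hf
      exact hq f ((hmin q).1.2 (Ideal.subset_span hf))
  · rintro q i x ⟨-, hx⟩ h0
    apply hx
    change aeval x (∏ j, initial (A q j) (lvss q j)) = 0
    rw [map_prod]
    exact Finset.prod_eq_zero (Finset.mem_univ i) h0
end
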